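/- arXiv:1109.5950 — 2 statements merged into one kernel-verified Lean document; each statement's English description precedes it below -/
import Mathlib

section
/- Let A be a complex unital Banach ∗-algebra with associative product satisfying ‖ab‖ ≤ C₀‖a‖‖b‖, continuous involution a ↦ a^*, and unit 1, and let (α_x)_{x∈ℝ^n} be a smooth polynomially bounded ℝ^n-action of order m ≥ 0 on A by continuous unital ∗-automorphisms (α_x(1) = 1 and α_x(a^*) = α_x(a)^*). Fix the pairing ⟨p,x⟩ := ⟪p, Mx⟫ with M invertible, |det M| = 1, and let θ be a real n×n matrix, with deformed product a ×_θ b := I((p,x) ↦ α_{θp}(a)α_x(b)). Then: (i) 1 is a unit for ×_θ, i.e. 1 ×_θ a = a and a ×_θ 1 = a for all a ∈ A; and (ii) if θ is skew-symmetric with respect to the pairing, i.e. ⟨p, θp'⟩ = −⟨p', θp⟩ for all p, p' ∈ ℝ^n, then (a ×_θ b)^* = b^* ×_θ a^* for all a, b ∈ A. -/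
open Filter MeasureTheory

noncomputable def pder {n : ℕ} {V : Type*} [NormedAddCommGroup V] [NormedSpace ℝ V]
    (i : Fin n) (f : (Fin n → ℝ) → V) : (Fin n → ℝ) → V :=
  fun x => fderiv ℝ f x (Pi.single i 1)

noncomputable def mder {n : ℕ} {V : Type*} [NormedAddCommGroup V] [NormedSpace ℝ V]
    (μ : Fin n → ℕ) (f : (Fin n → ℝ) → V) : (Fin n → ℝ) → V :=
  (List.finRange n).foldr (fun i g => (pder i)^[μ i] g) f

def mOrder {n : ℕ} (μ : Fin n → ℕ) : ℕ := ∑ i, μ i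

noncomputable def symWt {n : ℕ} (m ρ : ℝ) (μ : Fin n → ℕ) (x : Fin n → ℝ) : ℝ :=
  (1 + ‖x‖ ^ 2) ^ (-(m - ρ * (mOrder μ : ℝ)) / 2)

noncomputable def symNorm {n : ℕ} {V : Type*} [NormedAddCommGroup V] [NormedSpace ℝ V]
    (m ρ : ℝ) (μ : Fin n → ℕ) (F : (Fin n → ℝ) → V) : ℝ :=
  ⨆ x : Fin n → ℝ, symWt m ρ μ x * ‖mder μ F x‖

def IsSymbol {n : ℕ} {V : Type*} [NormedAddCommGroup V] [NormedSpace ℝ V]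
    (m ρ : ℝ) (F : (Fin n → ℝ) → V) : Prop :=
  ContDiff ℝ (⊤ : ℕ∞) F ∧ ∀ μ : Fin n → ℕ, ∃ C : ℝ, ∀ x, symWt m ρ μ x * ‖mder μ F x‖ ≤ C
def fstHalf {n : ℕ} (z : Fin (n + n) → ℝ) : Fin n → ℝ := fun i => z (Fin.castAdd n i)

def sndHalf {n : ℕ} (z : Fin (n + n) → ℝ) : Fin n → ℝ := fun i => z (Fin.natAdd n i)

noncomputable def pairM {n : ℕ} (M : Matrix (Fin n) (Fin n) ℝ) (p x : Fin n → ℝ) : ℝ :=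
  ∑ i, p i * M.mulVec x i

noncomputable def phase {n : ℕ} (M : Matrix (Fin n) (Fin n) ℝ) (z : Fin (n + n) → ℝ) : ℂ :=
  Complex.exp (Complex.I * (pairM M (fstHalf z) (sndHalf z) : ℂ))

noncomputable def cutInt {n : ℕ} {V : Type*} [NormedAddCommGroup V] [NormedSpace ℝ V]
    [NormedSpace ℂ V] [IsScalarTower ℝ ℂ V] (M : Matrix (Fin n) (Fin n) ℝ)
    (χ : (Fin (n + n) → ℝ) → ℝ) (z₀ : Fin (n + n) → ℝ) (ε : ℝ)
    (F : (Fin (n + n) → ℝ) → V) : V :=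
  ((2 * Real.pi) ^ n)⁻¹ • ∫ z : Fin (n + n) → ℝ, χ (ε • (z - z₀)) • (phase M z • F z)

def IsOscInt {n : ℕ} {V : Type*} [NormedAddCommGroup V] [NormedSpace ℝ V]
    [NormedSpace ℂ V] [IsScalarTower ℝ ℂ V] (M : Matrix (Fin n) (Fin n) ℝ)
    (F : (Fin (n + n) → ℝ) → V) (v : V) : Prop :=
  ∀ χ : (Fin (n + n) → ℝ) → ℝ, ContDiff ℝ (⊤ : ℕ∞) χ → HasCompactSupport χ →
    (∀ᶠ z in nhds (0 : Fin (n + n) → ℝ), χ z = 1) →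
    ∀ z₀ : Fin (n + n) → ℝ,
      Filter.Tendsto (fun ε : ℝ => cutInt M χ z₀ ε F) (nhdsWithin 0 (Set.Ioi 0)) (nhds v)

open Classical in
noncomputable def oscInt {n : ℕ} {V : Type*} [NormedAddCommGroup V] [NormedSpace ℝ V]
    [NormedSpace ℂ V] [IsScalarTower ℝ ℂ V] (M : Matrix (Fin n) (Fin n) ℝ)
    (F : (Fin (n + n) → ℝ) → V) : V :=
  if h : ∃ v, IsOscInt M F v then h.choose else 0

noncomputable def defProd {n : ℕ} {A : Type*} [NormedAddCommGroup A] [NormedSpace ℝ A]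
    [NormedSpace ℂ A] [IsScalarTower ℝ ℂ A]
    (M θ : Matrix (Fin n) (Fin n) ℝ) (mul : A →L[ℂ] A →L[ℂ] A)
    (α : (Fin n → ℝ) → A →L[ℂ] A) (a b : A) : A :=
  oscInt M (fun z : Fin (n + n) → ℝ =>
    mul (α (θ.mulVec (fstHalf z)) a) (α (sndHalf z) b))

/-- Weighted bound of order `s` on all derivatives of `F` up to order `K`. -/
def SymBd {E V : Type*} [NormedAddCommGroup E] [NormedSpace ℝ E] [NormedAddCommGroup V]
    [NormedSpace ℝ V] (K : ℕ) (s : ℤ) (C : ℝ) (F : E → V) : Prop :=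
  ∀ k ≤ K, ∀ z, ‖iteratedFDeriv ℝ k F z‖ ≤ C * (1 + ‖z‖) ^ s

namespace SymBd

theorem one_add_pos {E : Type*} [NormedAddCommGroup E] (z : E) : 0 < 1 + ‖z‖ := by positivity

variable {E E' V W U : Type*} [NormedAddCommGroup E] [NormedSpace ℝ E]
  [NormedAddCommGroup E'] [NormedSpace ℝ E']
  [NormedAddCommGroup V] [NormedSpace ℝ V] [NormedAddCommGroup W] [NormedSpace ℝ W]
  [NormedAddCommGroup U] [NormedSpace ℝ U] {K : ℕ} {s t : ℤ} {C D : ℝ} {F : E → V}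

theorem nonneg (h : SymBd K s C F) : 0 ≤ C := by
  have h1 := h 0 (Nat.zero_le _) 0
  simp only [norm_zero, add_zero, one_zpow, mul_one] at h1
  exact (norm_nonneg _).trans h1

theorem mono_order {L : ℕ} (h : SymBd K s C F) (hL : L ≤ K) : SymBd L s C F :=
  fun k hk z => h k (hk.trans hL) z

theorem mono (h : SymBd K s C F) (hst : s ≤ t) (hCD : C ≤ D) : SymBd K t D F := by
  intro k hk z
  refine (h k hk z).trans ?_
  have := h.nonneg
  gcongr
  · exact this.trans hCD
  · linarith [norm_nonneg z]

theorem norm_le (h : SymBd K s C F) (z : E) : ‖F z‖ ≤ C * (1 + ‖z‖) ^ s := by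
  simpa using h 0 (Nat.zero_le _) z

theorem fderiv (h : SymBd (K + 1) s C F) : SymBd K s C (fderiv ℝ F) := by
  intro k hk z
  rw [norm_iteratedFDeriv_fderiv]
  exact h (k + 1) (by omega) z

theorem of_fderiv (h0 : ∀ z, ‖F z‖ ≤ C * (1 + ‖z‖) ^ s) (h : SymBd K s C (_root_.fderiv ℝ F)) :
    SymBd (K + 1) s C F := by
  intro k hk z
  cases k with
  | zero => simpa using h0 z
  | succ k =>
    rw [← norm_iteratedFDeriv_fderiv]
    exact h k (by omega) z

theorem const (c : V) : SymBd K 0 ‖c‖ (fun _ : E => c) := by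
  intro k hk z
  rcases eq_or_ne k 0 with rfl | hk0
  · simp
  · simp [iteratedFDeriv_const_of_ne hk0]

theorem clm (T : E →L[ℝ] V) : SymBd K 1 ‖T‖ (fun z => T z) := by
  have h0 : ∀ z, ‖T z‖ ≤ ‖T‖ * (1 + ‖z‖) ^ (1 : ℤ) := fun z => by
    rw [zpow_one]
    refine (T.le_opNorm z).trans ?_
    gcongr
    linarith
  have h1 : SymBd K 1 ‖T‖ (_root_.fderiv ℝ (fun z => T z)) := by
    have : _root_.fderiv ℝ (fun z => T z) = fun _ => T := by ext1 z; exact T.fderiv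
    rw [this]
    exact (const T).mono (by norm_num) le_rfl
  exact (of_fderiv h0 h1).mono_order (Nat.le_succ K)

theorem add {G : E → V} (h : SymBd K s C F) (h' : SymBd K s D G)
    (hF : ContDiff ℝ (⊤ : ℕ∞) F) (hG : ContDiff ℝ (⊤ : ℕ∞) G) :
    SymBd K s (C + D) (fun z => F z + G z) := by
  intro k hk z
  have : iteratedFDeriv ℝ k (fun z => F z + G z) z
      = iteratedFDeriv ℝ k F z + iteratedFDeriv ℝ k G z :=
    iteratedFDeriv_add_apply (hF.of_le (by exact_mod_cast le_top)).contDiffAt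
      (hG.of_le (by exact_mod_cast le_top)).contDiffAt
  rw [this, add_mul]
  exact (norm_add_le _ _).trans (add_le_add (h k hk z) (h' k hk z))

theorem bilin (B : V →L[ℝ] W →L[ℝ] U) {G : E → W} (hF : ContDiff ℝ (⊤ : ℕ∞) F)
    (hG : ContDiff ℝ (⊤ : ℕ∞) G) (h : SymBd K s C F) (h' : SymBd K t D G) :
    SymBd K (s + t) (‖B‖ * (2 ^ K * (C * D))) (fun z => B (F z) (G z)) := by
  intro k hk z
  refine (B.norm_iteratedFDeriv_le_of_bilinear hF hG z
    (n := k) (by exact_mod_cast le_top)).trans ?_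
  rw [mul_assoc]
  gcongr
  have hC := h.nonneg
  have hD := h'.nonneg
  have hz := one_add_pos z
  have key : ∀ i ∈ Finset.range (k + 1), (k.choose i : ℝ) * ‖iteratedFDeriv ℝ i F z‖ *
      ‖iteratedFDeriv ℝ (k - i) G z‖ ≤ (k.choose i : ℝ) * (C * D * (1 + ‖z‖) ^ (s + t)) := by
    intro i hi
    have hi' := Finset.mem_range.1 hi
    have h1 := h i (by omega) z
    have h2 := h' (k - i) (by omega) z
    rw [mul_assoc, zpow_add₀ hz.ne']
    refine mul_le_mul_of_nonneg_left ?_ (Nat.cast_nonneg _)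
    calc _ ≤ (C * (1 + ‖z‖) ^ s) * (D * (1 + ‖z‖) ^ t) := by gcongr
      _ = _ := by ring
  refine (Finset.sum_le_sum key).trans ?_
  rw [← Finset.sum_mul]
  have : (∑ i ∈ Finset.range (k + 1), (k.choose i : ℝ)) = 2 ^ k := by
    exact_mod_cast Nat.sum_range_choose k
  rw [this]
  have h2 : (2 : ℝ) ^ k ≤ 2 ^ K := pow_le_pow_right₀ (by norm_num) hk
  calc _ ≤ (2 : ℝ) ^ K * (C * D * (1 + ‖z‖) ^ (s + t)) := by gcongr
    _ = _ := by ring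

theorem clm_comp (T : V →L[ℝ] W) (hF : ContDiff ℝ (⊤ : ℕ∞) F) (h : SymBd K s C F) :
    SymBd K s (‖T‖ * C) (fun z => T (F z)) := by
  intro k hk z
  refine (T.norm_iteratedFDeriv_comp_left hF.contDiffAt
    (by exact_mod_cast le_top : (k : WithTop ℕ∞) ≤ _)).trans ?_
  rw [mul_assoc]
  gcongr
  exact h k hk z

theorem comp_clm (A : E' →L[ℝ] E) (s : ℕ) (hF : ContDiff ℝ (⊤ : ℕ∞) F) (h : SymBd K s C F) :
    SymBd K s ((1 + ‖A‖) ^ (K + s) * C) (fun z => F (A z)) := by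
  intro k hk z
  have h1 : iteratedFDeriv ℝ k (F ∘ A) z = _ := A.iteratedFDeriv_comp_right hF z
    (by exact_mod_cast le_top : (k : WithTop ℕ∞) ≤ _)
  change ‖iteratedFDeriv ℝ k (F ∘ A) z‖ ≤ _
  rw [h1]
  refine (ContinuousMultilinearMap.norm_compContinuousLinearMap_le _ _).trans ?_
  have hC := h.nonneg
  have h2 : 1 + ‖A z‖ ≤ (1 + ‖A‖) * (1 + ‖z‖) := by
    nlinarith [A.le_opNorm z, norm_nonneg A, norm_nonneg z]
  have h3 := h k hk (A z)
  rw [zpow_natCast] at h3 ⊢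
  rw [Finset.prod_const, Finset.card_univ, Fintype.card_fin]
  calc _ ≤ (C * ((1 + ‖A‖) * (1 + ‖z‖)) ^ s) * (1 + ‖A‖) ^ K := by
        gcongr
        · exact h3.trans (by gcongr)
        · exact (pow_le_pow_left₀ (norm_nonneg _) (by linarith) k).trans
            (pow_le_pow_right₀ (by linarith [norm_nonneg A]) hk)
    _ = _ := by rw [mul_pow, pow_add]; ring

theorem comp_add (ξ : E) (s : ℕ) (h : SymBd K s C F) :
    SymBd K s (C * (1 + ‖ξ‖) ^ s) (fun z => F (z + ξ)) := by
  intro k hk z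
  rw [iteratedFDeriv_comp_add_right]
  have h3 := h k hk (z + ξ)
  rw [zpow_natCast] at h3 ⊢
  refine h3.trans ?_
  have hC := h.nonneg
  rw [mul_assoc, ← mul_pow]
  gcongr
  nlinarith [norm_add_le z ξ, norm_nonneg ξ, norm_nonneg z]

/-- A function vanishing on a large ball is small in a weight of higher order. -/
theorem of_vanish {R : ℝ} (hR : 0 < R) (h : SymBd K s C F) (h0 : ∀ z, ‖z‖ < R → F z = 0) :
    SymBd K (s + 1) (C / R) F := by
  intro k hk z
  have hC := h.nonneg
  have hz := one_add_pos z
  rcases lt_or_ge ‖z‖ R with hlt | hge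
  · have : F =ᶠ[nhds z] fun _ => 0 := by
      filter_upwards [(isOpen_lt continuous_norm continuous_const).mem_nhds hlt] with y hy
      exact h0 y hy
    rw [this.iteratedFDeriv ℝ k |>.eq_of_nhds]
    simp only [iteratedFDeriv_fun_zero, Pi.zero_apply, norm_zero]
    positivity
  · refine (h k hk z).trans ?_
    rw [zpow_add_one₀ hz.ne', div_mul_eq_mul_div, le_div_iff₀ hR, ← mul_assoc]
    gcongr
    linarith

theorem scale {ε : ℝ} (h0 : 0 ≤ ε) (h1 : ε ≤ 1) (v : E) (hF : ContDiff ℝ (⊤ : ℕ∞) F)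
    (h : SymBd K 0 C F) : SymBd K 0 C (fun z => F (ε • (z - v))) := by
  have key : SymBd K ((0 : ℕ) : ℤ) C (fun z => F (ε • z)) := by
    intro k hk z
    have h2 : iteratedFDeriv ℝ k (F ∘ (ε • ContinuousLinearMap.id ℝ E)) z = _ :=
      (ε • ContinuousLinearMap.id ℝ E).iteratedFDeriv_comp_right hF z
        (by exact_mod_cast le_top : (k : WithTop ℕ∞) ≤ _)
    change ‖iteratedFDeriv ℝ k (F ∘ (ε • ContinuousLinearMap.id ℝ E)) z‖ ≤ _
    rw [h2]
    refine (ContinuousMultilinearMap.norm_compContinuousLinearMap_le _ _).trans ?_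
    have h3 := h k hk (ε • z)
    have h4 : ‖ε • ContinuousLinearMap.id ℝ E‖ ≤ 1 := by
      rw [norm_smul, Real.norm_of_nonneg h0]
      have := ContinuousLinearMap.norm_id_le (𝕜 := ℝ) (E := E)
      nlinarith [norm_nonneg (ContinuousLinearMap.id ℝ E)]
    have hp : ∏ _i : Fin k, ‖ε • ContinuousLinearMap.id ℝ E‖ ≤ 1 :=
      Finset.prod_le_one (fun _ _ => norm_nonneg _) fun _ _ => h4
    have hC := h.nonneg
    simp only [zpow_zero, mul_one, Nat.cast_zero] at h3 ⊢
    calc _ ≤ C * 1 := by gcongr; exact h3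
      _ = C := mul_one C
  have := key.comp_add (-v) 0
  simpa [sub_eq_add_neg] using this

theorem exists_of_hasCompactSupport (hF : ContDiff ℝ (⊤ : ℕ∞) F) (hc : HasCompactSupport F)
    (K : ℕ) : ∃ C, SymBd K 0 C F := by
  have h : ∀ k : ℕ, ∃ C, ∀ z, ‖iteratedFDeriv ℝ k F z‖ ≤ C := fun k =>
    (hc.iteratedFDeriv k).exists_bound_of_continuous
      (hF.continuous_iteratedFDeriv (by exact_mod_cast le_top))
  choose C hC using h
  refine ⟨∑ k ∈ Finset.range (K + 1), C k, fun k hk z => ?_⟩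
  simp only [zpow_zero, mul_one]
  exact (hC k z).trans (Finset.single_le_sum (f := C)
    (fun i _ => (norm_nonneg _).trans (hC i 0)) (by simp; omega))

end SymBd

section OscillatoryEstimate

variable {E : Type*} [NormedAddCommGroup E] [NormedSpace ℝ E]

theorem symBd_inv_quadratic {ι : Type*} [Fintype ι] (ℓ : ι → E →L[ℝ] ℝ)
    (hℓ : ∀ z, ‖z‖ ^ 2 ≤ ∑ j, ℓ j z ^ 2) (K : ℕ) :
    ∃ C, SymBd K (-2) C (fun z => (1 + ∑ j, ℓ j z ^ 2)⁻¹) := by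
  have hw : ∀ z, 0 < 1 + ∑ j, ℓ j z ^ 2 := fun z => by positivity
  have hsm : ContDiff ℝ (⊤ : ℕ∞) (fun z => (1 + ∑ j, ℓ j z ^ 2)⁻¹) := by
    refine ContDiff.inv ?_ fun z => (hw z).ne'
    exact contDiff_const.add (ContDiff.sum fun j _ => (ℓ j).contDiff.pow 2)
  have h0 : ∀ z : E, ‖(1 + ∑ j, ℓ j z ^ 2)⁻¹‖ ≤ 2 * (1 + ‖z‖) ^ (-2 : ℤ) := by
    intro z
    have hz := SymBd.one_add_pos z
    rw [norm_inv, Real.norm_of_nonneg (hw z).le, zpow_neg, ← div_eq_mul_inv, inv_eq_one_div,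
      div_le_div_iff₀ (hw z) (by positivity)]
    norm_cast
    nlinarith [hℓ z, sq_nonneg (1 - ‖z‖)]
  induction K with
  | zero => exact ⟨2, fun k hk z => by obtain rfl : k = 0 := by omega
                                       simpa using h0 z⟩
  | succ K ih =>
    obtain ⟨C, hC⟩ := ih
    set u : E → ℝ := fun z => (1 + ∑ j, ℓ j z ^ 2)⁻¹ with hu
    let T : E →L[ℝ] E →L[ℝ] ℝ := -∑ j, (2 : ℝ) • (ℓ j).smulRight (ℓ j)
    have hd : fderiv ℝ u = fun z => (u z * u z) • T z := by
      ext1 z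
      have h1 : HasFDerivAt (fun z => 1 + ∑ j, ℓ j z ^ 2) (-T z) z := by
        have h2 : HasFDerivAt (fun z => ∑ j, ℓ j z ^ 2)
            (∑ j, ((2 : ℕ) * ℓ j z ^ (2 - 1)) • ℓ j) z := by
          refine HasFDerivAt.fun_sum fun j _ => ?_
          simpa using (ℓ j).hasFDerivAt.pow 2
        have hT : -T z = ∑ j, ((2 : ℕ) * ℓ j z ^ (2 - 1)) • ℓ j := by
          simp [T, smul_smul]
        rw [hT]
        exact h2.const_add 1
      have h3 := (hasDerivAt_inv (hw z).ne').comp_hasFDerivAt z h1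
      refine h3.fderiv.trans ?_
      simp only [hu, smul_neg, neg_smul, neg_neg]
      congr 1
      field_simp
    have huu := SymBd.bilin (ContinuousLinearMap.mul ℝ ℝ) hsm hsm hC hC
    have huuT := SymBd.bilin (ContinuousLinearMap.lsmul ℝ ℝ) (hsm.mul hsm) T.contDiff huu
      (SymBd.clm T)
    obtain ⟨D, hD⟩ : ∃ D, SymBd K (-2) D (fderiv ℝ u) :=
      ⟨_, by rw [hd]; exact huuT.mono (by norm_num) le_rfl⟩
    refine ⟨max 2 D, SymBd.of_fderiv (fun z => (h0 z).trans ?_)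
      (hD.mono le_rfl (le_max_right _ _))⟩
    have := SymBd.one_add_pos z
    gcongr
    exact le_max_left _ _

variable [FiniteDimensional ℝ E] [MeasurableSpace E] [BorelSpace E]
  {A : Type*} [NormedAddCommGroup A] [NormedSpace ℂ A]

/-- Integration by parts against an oscillating factor `ph`: a smooth compactly supported
amplitude of any polynomial growth order has its integral controlled by finitely many
weighted derivative bounds. -/
theorem exists_norm_integral_le (μ : Measure E) [μ.IsAddHaarMeasure] (ph : E → ℂ)
    (hph : ContDiff ℝ (⊤ : ℕ∞) ph) (hph1 : ∀ z, ‖ph z‖ ≤ 1)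
    {ι : Type*} [Fintype ι] (ℓ : ι → E →L[ℝ] ℝ) (v : ι → E) (κ : ℂ)
    (hκ : ∀ j z, (ℓ j z : ℂ) * ph z = κ * fderiv ℝ ph z (v j))
    (hℓ : ∀ z, ‖z‖ ^ 2 ≤ ∑ j, ℓ j z ^ 2) (d : ℕ) :
    ∃ (K : ℕ) (C : ℝ), 0 ≤ C ∧ ∀ (φ : E → A) (R : ℝ), ContDiff ℝ (⊤ : ℕ∞) φ →
      HasCompactSupport φ → SymBd K ((d : ℤ) - (Module.finrank ℝ E + 1)) R φ →
      ‖∫ z, ph z • φ z ∂μ‖ ≤ C * R := by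
  induction d with
  | zero =>
    refine ⟨0, ∫ z, (1 + ‖z‖) ^ (-(Module.finrank ℝ E + 1 : ℝ)) ∂μ,
      integral_nonneg fun z => by positivity, fun φ R hφ hc hR => ?_⟩
    rw [mul_comm, ← integral_const_mul]
    refine norm_integral_le_of_norm_le
      ((integrable_one_add_norm (by linarith)).const_mul R) (Eventually.of_forall fun z => ?_)
    have h1 := hR.norm_le z
    have h2 : (1 + ‖z‖) ^ (-(Module.finrank ℝ E + 1 : ℝ))
        = (1 + ‖z‖) ^ (((0 : ℕ) : ℤ) - (Module.finrank ℝ E + 1 : ℤ)) := by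
      rw [← Real.rpow_intCast]
      congr 1
      push_cast
      ring
    rw [h2, norm_smul]
    exact (mul_le_of_le_one_left (norm_nonneg _) (hph1 z)).trans h1
  | succ d ih =>
    obtain ⟨K, C, hC, ih⟩ := ih
    obtain ⟨c, hc⟩ := symBd_inv_quadratic ℓ hℓ (K + 1)
    set u : E → ℝ := fun z => (1 + ∑ j, ℓ j z ^ 2)⁻¹ with hu
    have hw : ∀ z, 0 < 1 + ∑ j, ℓ j z ^ 2 := fun z => by positivity
    have hus : ContDiff ℝ (⊤ : ℕ∞) u := by
      refine ContDiff.inv ?_ fun z => (hw z).ne'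
      exact contDiff_const.add (ContDiff.sum fun j _ => (ℓ j).contDiff.pow 2)
    have has : ∀ j, ContDiff ℝ (⊤ : ℕ∞) (fun z => u z * ℓ j z) :=
      fun j => hus.mul (ℓ j).contDiff
    have hab : ∀ j, ∃ c, SymBd (K + 1) (-1) c (fun z => u z * ℓ j z) := fun j =>
      ⟨_, (SymBd.bilin (ContinuousLinearMap.mul ℝ ℝ) hus (ℓ j).contDiff hc
        (SymBd.clm (ℓ j))).mono (by norm_num) le_rfl⟩
    choose c' hc' using hab
    let B := ContinuousLinearMap.lsmul ℝ ℝ (E := A)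
    let N : ℝ := ‖B‖ * 2 ^ (K + 1)
    refine ⟨K + 1, C * (N * c) + ∑ j, ‖κ‖ * (C * (‖v j‖ * (N * c' j))), ?_, ?_⟩
    · have h1 := hc.nonneg
      have h2 := fun j => (hc' j).nonneg
      have : 0 ≤ N := by positivity
      have h3 : ∀ j ∈ Finset.univ, 0 ≤ ‖κ‖ * (C * (‖v j‖ * (N * c' j))) := fun j _ => by
        have := h2 j
        positivity
      have := Finset.sum_nonneg h3
      positivity
    intro φ R hφ hφc hR
    have hψs : ∀ j, ContDiff ℝ (⊤ : ℕ∞) (fun z => (u z * ℓ j z) • φ z) := fun j => (has j).smul hφ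
    have hψc : ∀ j, HasCompactSupport (fun z => (u z * ℓ j z) • φ z) := fun j => hφc.smul_left
    have hdc : ∀ j, HasCompactSupport (fun z => fderiv ℝ (fun z => (u z * ℓ j z) • φ z) z (v j)) :=
      fun j => (hψc j).fderiv_apply ℝ (v j)
    have hds : ∀ j, ContDiff ℝ (⊤ : ℕ∞)
        (fun z => fderiv ℝ (fun z => (u z * ℓ j z) • φ z) z (v j)) := fun j =>
      ((hψs j).fderiv_right (m := (⊤ : ℕ∞)) (by norm_num)).clm_apply contDiff_const
    have hbu : ‖∫ z, ph z • (u z • φ z) ∂μ‖ ≤ C * (N * c * R) := by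
      refine ih _ _ (hus.smul hφ) hφc.smul_left ?_
      refine ((SymBd.bilin B hus hφ hc hR).mono_order (Nat.le_succ K)).mono ?_ (le_of_eq ?_)
      · push_cast; linarith
      · simp only [N]; ring
    have hbd : ∀ j, ‖∫ z, ph z • fderiv ℝ (fun z => (u z * ℓ j z) • φ z) z (v j) ∂μ‖
        ≤ C * (‖v j‖ * (N * c' j * R)) := by
      intro j
      refine ih _ _ (hds j) (hdc j) ?_
      have h1 := SymBd.bilin B (has j) hφ (hc' j) hR
      have h2 := SymBd.clm_comp (ContinuousLinearMap.apply ℝ A (v j))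
        ((hψs j).fderiv_right (m := (⊤ : ℕ∞)) (by norm_num)) h1.fderiv
      refine h2.mono ?_ ?_
      · push_cast; linarith
      · have h3 : ‖ContinuousLinearMap.apply ℝ A (v j)‖ ≤ ‖v j‖ :=
          ContinuousLinearMap.opNorm_le_bound _ (norm_nonneg _) fun f => by
            rw [ContinuousLinearMap.apply_apply, mul_comm]; exact f.le_opNorm _
        have h4 := h1.nonneg
        calc _ ≤ ‖v j‖ * (‖B‖ * (2 ^ (K + 1) * (c' j * R))) := by gcongr
          _ = _ := by simp only [N]; ring
    have hint : ∀ {f : E → A}, Continuous f → HasCompactSupport f →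
        Integrable (fun z => ph z • f z) μ := fun hf hfc =>
      (hph.continuous.smul hf).integrable_of_hasCompactSupport hfc.smul_left
    have hparts : ∀ j, ∫ z, ph z • ((ℓ j z : ℝ) • ((u z * ℓ j z) • φ z)) ∂μ
        = -(κ • ∫ z, ph z • fderiv ℝ (fun z => (u z * ℓ j z) • φ z) z (v j) ∂μ) := by
      intro j
      have h1 := integral_smul_fderiv_eq_neg_fderiv_smul_of_integrable (μ := μ) (f := ph)
        (g := fun z => (u z * ℓ j z) • φ z) (v := v j)
        (((hph.fderiv_right (m := (⊤ : ℕ∞)) (by norm_num)).clm_apply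
          contDiff_const).continuous.smul (hψs j).continuous
          |>.integrable_of_hasCompactSupport (hψc j).smul_left)
        (hint (hds j).continuous (hdc j)) (hint (hψs j).continuous (hψc j))
        (fun z _ => (hph.differentiable (by norm_num)) z)
        (fun z _ => ((hψs j).differentiable (by norm_num)) z)
      rw [h1, smul_neg, neg_neg, ← integral_smul]
      refine integral_congr_ae (Eventually.of_forall fun z => ?_)
      change ph z • (ℓ j z • ((u z * ℓ j z) • φ z))
        = κ • (fderiv ℝ ph z (v j) • ((u z * ℓ j z) • φ z))
      rw [smul_smul κ, ← hκ j z, ← Complex.coe_smul (ℓ j z), smul_smul, mul_comm (ph z)]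
    have hsplit : ∀ z, ph z • φ z = ph z • (u z • φ z)
        + ∑ j, ph z • ((ℓ j z : ℝ) • ((u z * ℓ j z) • φ z)) := by
      intro z
      rw [← Finset.smul_sum, ← smul_add]
      congr 1
      simp only [smul_smul]
      rw [← Finset.sum_smul, ← add_smul]
      have : u z + ∑ j, ℓ j z * (u z * ℓ j z) = 1 := by
        have h1 : ∑ j, ℓ j z * (u z * ℓ j z) = u z * ∑ j, ℓ j z ^ 2 := by
          rw [Finset.mul_sum]
          exact Finset.sum_congr rfl fun j _ => by ring
        rw [h1]
        have := (hw z).ne'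
        simp only [hu]
        field_simp
      rw [this, one_smul]
    have hsum : ∫ z, ph z • φ z ∂μ = ∫ z, ph z • (u z • φ z) ∂μ
        + ∑ j, -(κ • ∫ z, ph z • fderiv ℝ (fun z => (u z * ℓ j z) • φ z) z (v j) ∂μ) := by
      have hj : ∀ j, Integrable (fun z => ph z • ((ℓ j z : ℝ) • ((u z * ℓ j z) • φ z))) μ :=
        fun j => hint ((ℓ j).continuous.smul (hψs j).continuous) (hψc j).smul_left
      simp_rw [hsplit]
      rw [integral_add (f := fun z => ph z • (u z • φ z))
        (hint (hus.continuous.smul hφ.continuous) hφc.smul_left)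
        (integrable_finsetSum _ fun j _ => hj j), integral_finsetSum _ fun j _ => hj j]
      simp_rw [hparts]
    rw [hsum, add_mul, Finset.sum_mul]
    refine (norm_add_le _ _).trans (add_le_add (hbu.trans (le_of_eq (by ring))) ?_)
    refine (norm_sum_le _ _).trans (Finset.sum_le_sum fun j _ => ?_)
    rw [norm_neg, norm_smul]
    calc _ ≤ ‖κ‖ * (C * (‖v j‖ * (N * c' j * R))) := by gcongr; exact hbd j
      _ = _ := by ring

end OscillatoryEstimate

section StandardPhase

open scoped InnerProductSpace

variable {X : Type*} [NormedAddCommGroup X] [InnerProductSpace ℝ X]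

/-- The standard oscillating factor `exp (2πi⟪p, x⟫)` on `X × X`. -/
noncomputable def oscPh (v : X × X) : ℂ :=
  Complex.exp ((2 * Real.pi * ⟪v.1, v.2⟫_ℝ : ℝ) * Complex.I)

theorem norm_oscPh (v : X × X) : ‖oscPh v‖ = 1 := Complex.norm_exp_ofReal_mul_I _

theorem contDiff_oscPh : ContDiff ℝ (⊤ : ℕ∞) (oscPh (X := X)) := by
  refine ContDiff.cexp (ContDiff.mul ?_ contDiff_const)
  exact Complex.ofRealCLM.contDiff.comp (contDiff_const.mul (contDiff_fst.inner ℝ contDiff_snd))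

theorem fderiv_oscPh_apply (v w : X × X) : fderiv ℝ oscPh v w
    = (2 * Real.pi * Complex.I) * ((⟪w.1, v.2⟫_ℝ + ⟪v.1, w.2⟫_ℝ : ℝ) : ℂ) * oscPh v := by
  have h1 : HasFDerivAt (fun v : X × X => ⟪v.1, v.2⟫_ℝ) _ v :=
    hasFDerivAt_fst.inner ℝ hasFDerivAt_snd
  have h2 := ((Complex.ofRealCLM.hasFDerivAt.comp v
    (h1.const_mul (2 * Real.pi))).mul_const Complex.I).cexp
  have h3 : HasFDerivAt (oscPh (X := X)) _ v := h2
  rw [h3.fderiv]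
  simp [oscPh, fderivInnerCLM_apply]
  ring

/-- A smooth compactly supported cutoff equal to `1` near the origin. -/
structure IsCut {E : Type*} [NormedAddCommGroup E] [NormedSpace ℝ E] (χ : E → ℝ) : Prop where
  contDiff : ContDiff ℝ (⊤ : ℕ∞) χ
  compact : HasCompactSupport χ
  one : ∀ᶠ z in nhds 0, χ z = 1

theorem exists_isCut (E : Type*) [NormedAddCommGroup E] [NormedSpace ℝ E]
    [FiniteDimensional ℝ E] : ∃ χ : E → ℝ, IsCut χ := by
  let b : ContDiffBump (0 : E) := ⟨1, 2, one_pos, one_lt_two⟩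
  exact ⟨b, b.contDiff, b.hasCompactSupport, b.eventuallyEq_one⟩

theorem IsCut.apply_zero {χ : X → ℝ} (h : IsCut χ) : χ 0 = 1 := h.one.self_of_nhds

section Scale

variable {E : Type*} [NormedAddCommGroup E] [NormedSpace ℝ E] {χ : E → ℝ}

theorem IsCut.contDiff_scale (h : IsCut χ) (ε : ℝ) (v₀ : E) :
    ContDiff ℝ (⊤ : ℕ∞) (fun v => χ (ε • (v - v₀))) :=
  h.contDiff.comp (contDiff_const.smul (contDiff_id.sub contDiff_const))

theorem IsCut.compact_scale (h : IsCut χ) {ε : ℝ} (hε : ε ≠ 0) (v₀ : E) :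
    HasCompactSupport (fun v => χ (ε • (v - v₀))) :=
  h.compact.comp_homeomorph ((Homeomorph.subRight v₀).trans (Homeomorph.smulOfNeZero ε hε))

theorem IsCut.exists_radius (h : IsCut χ) : ∃ r > 0, ∀ z, ‖z‖ < r → χ z = 1 := by
  obtain ⟨r, hr, h1⟩ := Metric.eventually_nhds_iff.1 h.one
  exact ⟨r, hr, fun z hz => h1 (by simpa using hz)⟩

end Scale

variable [FiniteDimensional ℝ X] [MeasurableSpace X] [BorelSpace X]
  {A : Type*} [NormedAddCommGroup A] [NormedSpace ℂ A]

theorem exists_norm_integral_oscPh_le (s : ℕ) :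
    ∃ (K : ℕ) (C : ℝ), 0 ≤ C ∧ ∀ (φ : X × X → A) (R : ℝ), ContDiff ℝ (⊤ : ℕ∞) φ →
      HasCompactSupport φ → SymBd K s R φ → ‖∫ z, oscPh z • φ z‖ ≤ C * R := by
  let b := stdOrthonormalBasis ℝ X
  let ι := Fin (Module.finrank ℝ X)
  let ℓ : ι ⊕ ι → X × X →L[ℝ] ℝ := Sum.elim
    (fun j => (innerSL ℝ (b j)).comp (ContinuousLinearMap.snd ℝ X X))
    (fun j => (innerSL ℝ (b j)).comp (ContinuousLinearMap.fst ℝ X X))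
  let v : ι ⊕ ι → X × X := Sum.elim (fun j => (b j, 0)) (fun j => (0, b j))
  have hI : (2 * Real.pi * Complex.I) ≠ 0 := by
    simp [Real.pi_ne_zero]
  have : (volume : Measure (X × X)).IsAddHaarMeasure :=
    inferInstanceAs ((volume : Measure X).prod volume).IsAddHaarMeasure
  have := exists_norm_integral_le (A := A) (volume : Measure (X × X)) oscPh contDiff_oscPh
    (fun z => (norm_oscPh z).le) ℓ v (2 * Real.pi * Complex.I)⁻¹ ?_ ?_
    (s + (Module.finrank ℝ (X × X) + 1))
  · simpa using this
  · rintro (j | j) z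
    · rw [fderiv_oscPh_apply, ← mul_assoc, ← mul_assoc, inv_mul_cancel₀ hI]
      simp [ℓ, v]
    · rw [fderiv_oscPh_apply, ← mul_assoc, ← mul_assoc, inv_mul_cancel₀ hI]
      simp [ℓ, v, real_inner_comm]
  · intro z
    rw [Fintype.sum_sum_type]
    have h1 : ∑ j, ℓ (Sum.inl j) z ^ 2 = ‖z.2‖ ^ 2 := b.sum_sq_inner_right z.2
    have h2 : ∑ j, ℓ (Sum.inr j) z ^ 2 = ‖z.1‖ ^ 2 := b.sum_sq_inner_right z.1
    rw [h1, h2, Prod.norm_def]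
    rcases max_choice ‖z.1‖ ‖z.2‖ with h | h <;> rw [h] <;> nlinarith [sq_nonneg ‖z.1‖,
      sq_nonneg ‖z.2‖]

/-- The oscillatory integral of `F` on `X × X` regularized by a rescaled cutoff. -/
noncomputable def cutT (χ : X × X → ℝ) (v₀ : X × X) (ε : ℝ) (F : X × X → A) : A :=
  ∫ v, oscPh v • (χ (ε • (v - v₀)) • F v)

theorem integrable_cutT {χ : X × X → ℝ} (hχ : IsCut χ) (v₀ : X × X) {ε : ℝ} (hε : 0 < ε)
    {F : X × X → A} (hF : Continuous F) :
    Integrable (fun v => oscPh v • (χ (ε • (v - v₀)) • F v)) :=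
  (contDiff_oscPh.continuous.smul ((hχ.contDiff_scale ε v₀).continuous.smul
    hF)).integrable_of_hasCompactSupport ((hχ.compact_scale hε.ne' v₀).smul_right).smul_left

theorem exists_norm_cutT_le {χ : X × X → ℝ} (hχ : IsCut χ) (s : ℕ) :
    ∃ (K : ℕ) (C : ℝ), 0 ≤ C ∧ ∀ (F : X × X → A) (R : ℝ), ContDiff ℝ (⊤ : ℕ∞) F →
      SymBd K s R F → ∀ v₀ ε, 0 < ε → ε ≤ 1 → ‖cutT χ v₀ ε F‖ ≤ C * R := by
  obtain ⟨K, C, hC, h⟩ := exists_norm_integral_oscPh_le (X := X) (A := A) s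
  obtain ⟨c, hc⟩ := SymBd.exists_of_hasCompactSupport hχ.contDiff hχ.compact K
  let B := ContinuousLinearMap.lsmul ℝ ℝ (E := A)
  have hc0 := hc.nonneg
  refine ⟨K, C * (‖B‖ * (2 ^ K * c)), by positivity, fun F R hF hR v₀ ε hε hε1 => ?_⟩
  refine (h _ _ ((hχ.contDiff_scale ε v₀).smul hF) (hχ.compact_scale hε.ne' v₀).smul_right
    ((SymBd.bilin B (hχ.contDiff_scale ε v₀) hF (hc.scale hε.le hε1 v₀ hχ.contDiff) hR).mono
    (by simp) le_rfl)).trans (le_of_eq (by ring))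

/-- The limit of the regularized integrals does not depend on the cutoff. -/
theorem tendsto_cutT_sub {χ χ' : X × X → ℝ} (hχ : IsCut χ) (hχ' : IsCut χ') (v₀ v₀' : X × X)
    {s : ℕ} {F : X × X → A} (hF : ContDiff ℝ (⊤ : ℕ∞) F) (hFs : ∀ K, ∃ C, SymBd K s C F) :
    Tendsto (fun ε => cutT χ v₀ ε F - cutT χ' v₀' ε F) (nhdsWithin 0 (Set.Ioi 0)) (nhds 0) := by
  obtain ⟨K, C, hC, h⟩ := exists_norm_integral_oscPh_le (X := X) (A := A) (s + 1)
  obtain ⟨c, hc⟩ := SymBd.exists_of_hasCompactSupport hχ.contDiff hχ.compact K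
  obtain ⟨c', hc'⟩ := SymBd.exists_of_hasCompactSupport hχ'.contDiff hχ'.compact K
  obtain ⟨R, hR⟩ := hFs K
  obtain ⟨r, hr, hr1⟩ := hχ.exists_radius
  obtain ⟨r', hr', hr1'⟩ := hχ'.exists_radius
  let B := ContinuousLinearMap.lsmul ℝ ℝ (E := A)
  let q := min r r' / 2
  have hq : 0 < q := by have := lt_min hr hr'; positivity
  have hsmall : ∀ᶠ ε : ℝ in nhdsWithin 0 (Set.Ioi 0), ε * (‖v₀‖ + ‖v₀'‖) < q := by
    have : Tendsto (fun ε : ℝ => ε * (‖v₀‖ + ‖v₀'‖)) (nhdsWithin 0 (Set.Ioi 0)) (nhds 0) := by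
      have : Tendsto (fun ε : ℝ => ε * (‖v₀‖ + ‖v₀'‖)) (nhds 0) (nhds (0 * (‖v₀‖ + ‖v₀'‖))) :=
        (continuous_id.mul continuous_const).tendsto 0
      rw [zero_mul] at this
      exact this.mono_left nhdsWithin_le_nhds
    exact this.eventually (gt_mem_nhds hq)
  have hone : ∀ᶠ ε : ℝ in nhdsWithin 0 (Set.Ioi 0), ε < 1 :=
    nhdsWithin_le_nhds (gt_mem_nhds one_pos)
  refine squeeze_zero_norm' (a := fun ε => C * (‖B‖ * (2 ^ K * ((c + c') / q * R))) * ε) ?_ ?_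
  · filter_upwards [hsmall, hone, self_mem_nhdsWithin] with ε hs h1 h0
    have h0 : 0 < ε := h0
    let D : X × X → ℝ := fun v => χ (ε • (v - v₀)) - χ' (ε • (v - v₀'))
    have hDs : ContDiff ℝ (⊤ : ℕ∞) D := (hχ.contDiff_scale ε v₀).sub (hχ'.contDiff_scale ε v₀')
    have hDc : HasCompactSupport D :=
      (hχ.compact_scale h0.ne' v₀).sub (hχ'.compact_scale h0.ne' v₀')
    have hDb : SymBd K 0 (c + c') D := by
      have h2 := SymBd.clm_comp (-ContinuousLinearMap.id ℝ ℝ) (hχ'.contDiff_scale ε v₀')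
        (hc'.scale h0.le h1.le v₀' hχ'.contDiff)
      have h3 := (hc.scale h0.le h1.le v₀ hχ.contDiff).add h2 (hχ.contDiff_scale ε v₀)
        (ContinuousLinearMap.contDiff _ |>.comp (hχ'.contDiff_scale ε v₀'))
      have h4 : D = fun v => χ (ε • (v - v₀))
          + (-ContinuousLinearMap.id ℝ ℝ) (χ' (ε • (v - v₀'))) := by
        ext v
        simp [D, sub_eq_add_neg]
      rw [h4]
      refine h3.mono le_rfl ?_
      have := hc'.nonneg
      have h5 : ‖-ContinuousLinearMap.id ℝ ℝ‖ ≤ 1 := by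
        rw [norm_neg]; exact ContinuousLinearMap.norm_id_le
      nlinarith
    have hD0 : ∀ v, ‖v‖ < q / ε → D v = 0 := by
      intro v hv
      rw [lt_div_iff₀ h0] at hv
      have hb : ∀ w : X × X, ‖w‖ ≤ ‖v₀‖ + ‖v₀'‖ → ‖ε • (v - w)‖ < min r r' := by
        intro w hw
        rw [norm_smul, Real.norm_of_nonneg h0.le]
        have h2 := norm_sub_le v w
        have h3 : 2 * q = min r r' := by simp only [q]; ring
        nlinarith
      have e1 := hr1 _ ((hb v₀ (by linarith [norm_nonneg v₀'])).trans_le (min_le_left _ _))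
      have e2 := hr1' _ ((hb v₀' (by linarith [norm_nonneg v₀])).trans_le (min_le_right _ _))
      simp [D, e1, e2]
    have hDb' := hDb.of_vanish (div_pos hq h0) hD0
    have heq : cutT χ v₀ ε F - cutT χ' v₀' ε F = ∫ v, oscPh v • (D v • F v) := by
      rw [cutT, cutT, ← integral_sub (integrable_cutT hχ v₀ h0 hF.continuous)
        (integrable_cutT hχ' v₀' h0 hF.continuous)]
      simp [D, ← smul_sub, ← sub_smul]
    rw [heq]
    refine (h _ _ (hDs.smul hF) hDc.smul_right
      ((SymBd.bilin B hDs hF hDb' hR).mono (by push_cast; linarith) le_rfl)).trans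
      (le_of_eq ?_)
    field_simp
  · have : Tendsto (fun ε : ℝ => C * (‖B‖ * (2 ^ K * ((c + c') / q * R))) * ε) (nhds 0)
        (nhds (C * (‖B‖ * (2 ^ K * ((c + c') / q * R))) * 0)) :=
      (continuous_const.mul continuous_id).tendsto 0
    rw [mul_zero] at this
    exact this.mono_left nhdsWithin_le_nhds

end StandardPhase

section DeltaLimit

open scoped InnerProductSpace FourierTransform SchwartzMap

variable {X : Type*} [NormedAddCommGroup X] [InnerProductSpace ℝ X] [FiniteDimensional ℝ X]
  [MeasurableSpace X] [BorelSpace X]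
  {A : Type*} [NormedAddCommGroup A] [NormedSpace ℂ A]

/-- A smooth function all of whose derivatives have growth of order at most `s`. -/
structure IsSym {E V : Type*} [NormedAddCommGroup E] [NormedSpace ℝ E] [NormedAddCommGroup V]
    [NormedSpace ℝ V] (s : ℕ) (F : E → V) : Prop where
  contDiff : ContDiff ℝ (⊤ : ℕ∞) F
  bound : ∀ K, ∃ C, SymBd K s C F

theorem IsSym.comp_clm {E E' V : Type*} [NormedAddCommGroup E] [NormedSpace ℝ E]
    [NormedAddCommGroup E'] [NormedSpace ℝ E'] [NormedAddCommGroup V] [NormedSpace ℝ V] {s : ℕ}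
    {F : E → V} (hF : IsSym s F) (T : E' →L[ℝ] E) : IsSym s (fun z => F (T z)) :=
  ⟨hF.contDiff.comp T.contDiff, fun K => let ⟨_, h⟩ := hF.bound K; ⟨_, h.comp_clm T s hF.contDiff⟩⟩

theorem IsSym.exists_norm_le {E V : Type*} [NormedAddCommGroup E] [NormedSpace ℝ E]
    [NormedAddCommGroup V] [NormedSpace ℝ V] {s : ℕ} {F : E → V} (hF : IsSym s F) :
    ∃ C, 0 ≤ C ∧ ∀ z, ‖F z‖ ≤ C * (1 + ‖z‖) ^ s := by
  obtain ⟨C, hC⟩ := hF.bound 0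
  exact ⟨C, hC.nonneg, fun z => by simpa using hC.norm_le z⟩

theorem integrable_schwartz_mul_pow {V : Type*} [NormedAddCommGroup V] [NormedSpace ℝ V]
    (φ : 𝓢(X, V)) (s : ℕ) : Integrable (fun y => ‖φ y‖ * (1 + ‖y‖) ^ s) := by
  have h1 := ((φ.integrable_pow_mul volume 0).add (φ.integrable_pow_mul volume s)).const_mul
    ((2 : ℝ) ^ s)
  refine h1.mono' (by fun_prop) (Eventually.of_forall fun y => ?_)
  rw [Real.norm_of_nonneg (by positivity)]
  have : (1 + ‖y‖) ^ s ≤ 2 ^ s * (1 + ‖y‖ ^ s) := by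
    refine (add_pow_le zero_le_one (norm_nonneg y) s).trans ?_
    rw [one_pow]
    gcongr
    · norm_num
    · omega
  simp only [Pi.add_apply, pow_zero, one_mul]
  nlinarith [norm_nonneg (φ y)]

/-- Fourier inversion in the sense of oscillatory integrals. -/
theorem tendsto_cutT_snd [CompleteSpace A] {χ : X × X → ℝ} (hχ : IsCut χ) (v₀ : X × X) {s : ℕ}
    {g : X → A} (hg : IsSym s g) :
    Tendsto (fun ε => cutT χ v₀ ε (fun v => g v.2)) (nhdsWithin 0 (Set.Ioi 0)) (nhds (g 0)) := by
  obtain ⟨b, hb⟩ := exists_isCut X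
  let ψ : X × X → ℝ := fun v => b v.1 * b v.2
  have hψ : IsCut ψ := by
    refine ⟨(hb.contDiff.comp contDiff_fst).mul (hb.contDiff.comp contDiff_snd), ?_, ?_⟩
    · refine HasCompactSupport.of_support_subset_isCompact
        ((hb.compact.isCompact).prod (hb.compact.isCompact)) fun v hv => ?_
      have := mul_ne_zero_iff.1 hv
      exact ⟨subset_tsupport _ this.1, subset_tsupport _ this.2⟩
    · have h1 : ∀ᶠ v : X × X in nhds 0, b v.1 = 1 :=
        (continuous_fst.tendsto (0 : X × X)).eventually hb.one
      have h2 : ∀ᶠ v : X × X in nhds 0, b v.2 = 1 :=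
        (continuous_snd.tendsto (0 : X × X)).eventually hb.one
      filter_upwards [h1, h2] with v e1 e2
      simp [ψ, e1, e2]
  have hgs : IsSym s (fun v : X × X => g v.2) := hg.comp_clm (ContinuousLinearMap.snd ℝ X X)
  have hdiff := tendsto_cutT_sub hχ hψ v₀ 0 hgs.contDiff hgs.bound
  suffices h : Tendsto (fun ε => cutT ψ 0 ε (fun v => g v.2)) (nhdsWithin 0 (Set.Ioi 0))
      (nhds (g 0)) by simpa using hdiff.add h
  let bC : 𝓢(X, ℂ) := HasCompactSupport.toSchwartzMap (f := fun x => (b x : ℂ))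
    (hb.compact.comp_left (g := fun r : ℝ => (r : ℂ)) (by simp))
    (Complex.ofRealCLM.contDiff.comp hb.contDiff)
  let hh : 𝓢(X, ℂ) := 𝓕⁻ bC
  have hbC : ∀ x, bC x = b x := fun x => rfl
  have hhh : ∀ y, hh y = ∫ u, Complex.exp ((2 * Real.pi * ⟪u, y⟫_ℝ : ℝ) * Complex.I) * b u := by
    intro y
    have : hh y = 𝓕⁻ (bC : X → ℂ) y := by
      rw [SchwartzMap.fourierInv_coe]
    rw [this, Real.fourierInv_eq']
    simp [hbC]
  have hint : ∫ y, hh y = 1 := by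
    have h1 : (𝓕 hh) 0 = bC 0 := by simp [hh]
    rw [SchwartzMap.fourier_coe, Real.fourier_eq'] at h1
    simpa [hbC, hb.apply_zero] using h1
  have hform : ∀ ε : ℝ, 0 < ε → cutT ψ 0 ε (fun v => g v.2)
      = ∫ y, hh y • (b ((ε * ε) • y) • g (ε • y)) := by
    intro ε hε
    have hi := integrable_cutT hψ 0 hε (hgs.contDiff.continuous)
    rw [cutT, show (volume : Measure (X × X)) = (volume : Measure X).prod volume from rfl,
      integral_prod_symm _ hi]
    have hd : (0 : ℝ) < ε ^ Module.finrank ℝ X := by positivity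
    have h1 : ∀ x : X, ∫ p : X, oscPh (p, x) • (ψ (ε • ((p, x) - 0)) • g x)
        = (ε ^ Module.finrank ℝ X)⁻¹ • (hh (ε⁻¹ • x) • (b (ε • x) • g x)) := by
      intro x
      have h2 : hh (ε⁻¹ • x) = (ε ^ Module.finrank ℝ X) •
          ∫ p, Complex.exp ((2 * Real.pi * ⟪p, x⟫_ℝ : ℝ) * Complex.I) * b (ε • p) := by
        have h3 := Measure.integral_comp_smul (volume : Measure X) (fun u =>
          Complex.exp ((2 * Real.pi * ⟪u, ε⁻¹ • x⟫_ℝ : ℝ) * Complex.I) * b u) ε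
        rw [abs_of_pos (by positivity), ← hhh] at h3
        rw [← inv_smul_eq_iff₀ hd.ne', ← h3]
        simp [inner_smul_left, inner_smul_right, hε.ne']
      rw [h2, smul_assoc, inv_smul_smul₀ hd.ne', ← integral_smul_const]
      refine integral_congr_ae (Eventually.of_forall fun p => ?_)
      simp only [oscPh, ψ, sub_zero, Prod.smul_mk, mul_smul]
      rw [Complex.coe_smul]
    simp_rw [h1]
    rw [integral_smul]
    have h4 := Measure.integral_comp_inv_smul (volume : Measure X)
      (fun y => hh y • (b ((ε * ε) • y) • g (ε • y))) ε
    rw [abs_of_pos hd] at h4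
    rw [← inv_smul_eq_iff₀ hd.ne'] at h4
    rw [← h4]
    simp [smul_smul, hε.ne']
  have hlim : Tendsto (fun ε : ℝ => ∫ y, hh y • (b ((ε * ε) • y) • g (ε • y)))
      (nhdsWithin 0 (Set.Ioi 0)) (nhds (∫ y, hh y • g 0)) := by
    obtain ⟨C, hC0, hC⟩ := hg.exists_norm_le
    obtain ⟨c, hc⟩ := hb.compact.exists_bound_of_continuous hb.contDiff.continuous
    have hc0 : 0 ≤ c := (norm_nonneg _).trans (hc 0)
    have hgc := hg.contDiff.continuous
    have hbc := hb.contDiff.continuous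
    refine tendsto_integral_filter_of_dominated_convergence
      (fun y => (c * C) * (‖hh y‖ * (1 + ‖y‖) ^ s)) ?_ ?_
      ((integrable_schwartz_mul_pow hh s).const_mul _) ?_
    · refine Eventually.of_forall fun ε => Continuous.aestronglyMeasurable ?_
      exact hh.continuous.smul ((hbc.comp (continuous_const_smul _)).smul
        (hgc.comp (continuous_const_smul _)))
    · filter_upwards [self_mem_nhdsWithin, nhdsWithin_le_nhds (gt_mem_nhds one_pos)] with ε h0 h1
      have h0 : 0 < ε := h0
      refine Eventually.of_forall fun y => ?_
      rw [norm_smul, norm_smul]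
      have e1 := hc ((ε * ε) • y)
      have e2 : ‖g (ε • y)‖ ≤ C * (1 + ‖y‖) ^ s := by
        refine (hC _).trans ?_
        rw [norm_smul, Real.norm_of_nonneg h0.le]
        gcongr
        nlinarith [norm_nonneg y]
      calc ‖hh y‖ * (‖b ((ε * ε) • y)‖ * ‖g (ε • y)‖)
          ≤ ‖hh y‖ * (c * (C * (1 + ‖y‖) ^ s)) := by gcongr
        _ = _ := by ring
    · refine Eventually.of_forall fun y => Tendsto.mono_left ?_ nhdsWithin_le_nhds
      have : Continuous fun ε : ℝ => hh y • (b ((ε * ε) • y) • g (ε • y)) :=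
        continuous_const.smul ((hbc.comp ((continuous_id.mul continuous_id).smul
          continuous_const)).smul (hgc.comp (continuous_id.smul continuous_const)))
      simpa [hb.apply_zero] using this.tendsto 0
  rw [integral_smul_const, hint, one_smul] at hlim
  refine hlim.congr' ?_
  filter_upwards [self_mem_nhdsWithin] with ε hε
  exact (hform ε hε).symm

end DeltaLimit

section SchwartzLimit

open scoped InnerProductSpace FourierTransform SchwartzMap

variable {X : Type*} [NormedAddCommGroup X] [InnerProductSpace ℝ X] [FiniteDimensional ℝ X]
  [MeasurableSpace X] [BorelSpace X]
  {A : Type*} [NormedAddCommGroup A] [NormedSpace ℂ A]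

theorem cutT_modulate (χ : X × X → ℝ) (v₀ : X × X) (ε : ℝ) (g : X → A) (η : X) :
    cutT χ v₀ ε (fun v => oscPh (v.1, η) • g v.2)
      = cutT χ (v₀ + (0, η)) ε (fun v => g (v.2 + -η)) := by
  have : (volume : Measure (X × X)).IsAddHaarMeasure :=
    inferInstanceAs ((volume : Measure X).prod volume).IsAddHaarMeasure
  rw [cutT, cutT, ← integral_sub_right_eq_self _ ((0, η) : X × X)]
  refine integral_congr_ae (Eventually.of_forall fun v => ?_)
  have h1 : oscPh v = oscPh (v - (0, η)) * oscPh (v.1, η) := by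
    simp only [oscPh, ← Complex.exp_add]
    congr 1
    simp only [Prod.fst_sub, Prod.snd_sub, sub_zero, inner_sub_right]
    push_cast
    ring
  have h2 : v - (0, η) - v₀ = v - (v₀ + (0, η)) := by abel
  simp only [h1, h2]
  rw [mul_smul, smul_comm (oscPh (v.1, η)) (χ _)]
  simp [sub_eq_add_neg]

theorem tendsto_cutT_modulate [CompleteSpace A] {χ : X × X → ℝ} (hχ : IsCut χ) (v₀ : X × X)
    {s : ℕ} {g : X → A} (hg : IsSym s g) (η : X) :
    Tendsto (fun ε => cutT χ v₀ ε (fun v => oscPh (v.1, η) • g v.2)) (nhdsWithin 0 (Set.Ioi 0))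
      (nhds (g (-η))) := by
  have h : IsSym s (fun x => g (x + -η)) :=
    ⟨hg.contDiff.comp (contDiff_id.add contDiff_const),
      fun K => let ⟨_, h⟩ := hg.bound K; ⟨_, h.comp_add (-η) s⟩⟩
  simp_rw [cutT_modulate]
  simpa using tendsto_cutT_snd hχ (v₀ + (0, η)) h

theorem exists_norm_cutT_modulate_le {χ : X × X → ℝ} (hχ : IsCut χ)
    {s : ℕ} {g : X → A} (hg : IsSym s g) :
    ∃ C, 0 ≤ C ∧ ∀ η v₀ ε, 0 < ε → ε ≤ 1 →
      ‖cutT χ v₀ ε (fun v => oscPh (v.1, η) • g v.2)‖ ≤ C * (1 + ‖η‖) ^ s := by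
  obtain ⟨K, C, hC, h⟩ := exists_norm_cutT_le (A := A) hχ s
  obtain ⟨c, hc⟩ := hg.bound K
  have hc0 := hc.nonneg
  refine ⟨C * ((1 + ‖ContinuousLinearMap.snd ℝ X X‖) ^ (K + s) * c), by positivity,
    fun η v₀ ε h0 h1 => ?_⟩
  rw [cutT_modulate]
  have h2 : ContDiff ℝ (⊤ : ℕ∞) (fun x => g (x + -η)) :=
    hg.contDiff.comp (contDiff_id.add contDiff_const)
  have h3 := (hc.comp_add (-η) s).comp_clm (ContinuousLinearMap.snd ℝ X X) s h2
  refine (h _ _ (h2.comp contDiff_snd) h3 _ ε h0 h1).trans (le_of_eq ?_)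
  rw [norm_neg]
  ring

theorem SchwartzMap.eq_integral_oscPh [CompleteSpace A] (φ : 𝓢(X, A)) (S : X →L[ℝ] X) (p : X) :
    φ (S p) = ∫ ξ, oscPh (p, S.adjoint ξ) • (𝓕 φ : 𝓢(X, A)) ξ := by
  have h : φ (S p) = 𝓕⁻ (𝓕 φ : 𝓢(X, A)) (S p) := by simp
  rw [h, SchwartzMap.fourierInv_coe, Real.fourierInv_eq']
  refine integral_congr_ae (Eventually.of_forall fun ξ => ?_)
  simp [oscPh, ContinuousLinearMap.adjoint_inner_right, real_inner_comm]

theorem tendsto_cutT_schwartz [CompleteSpace A] (mul : A →L[ℂ] A →L[ℂ] A) (φ : 𝓢(X, A))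
    (S T : X →L[ℝ] X) {χ : X × X → ℝ} (hχ : IsCut χ) (v₀ : X × X) {s : ℕ} {g : X → A}
    (hg : IsSym s g) :
    Tendsto (fun ε => cutT χ v₀ ε (fun v => mul (φ (S v.1)) (g (T v.2))))
      (nhdsWithin 0 (Set.Ioi 0)) (nhds (∫ ξ, mul ((𝓕 φ : 𝓢(X, A)) ξ) (g (-(T.comp S.adjoint) ξ)))) := by
  have hG : IsSym s (fun x => g (T x)) := hg.comp_clm T
  have hgc : Continuous g := hg.contDiff.continuous
  have hφc : Continuous (𝓕 φ : 𝓢(X, A)) := (𝓕 φ : 𝓢(X, A)).continuous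
  have hoc : Continuous (oscPh (X := X)) := contDiff_oscPh.continuous
  have hform : ∀ ε : ℝ, 0 < ε → cutT χ v₀ ε (fun v => mul (φ (S v.1)) (g (T v.2)))
      = ∫ ξ, mul ((𝓕 φ : 𝓢(X, A)) ξ) (cutT χ v₀ ε (fun v => oscPh (v.1, S.adjoint ξ) • g (T v.2))) := by
    intro ε hε
    have hχc := (hχ.contDiff_scale ε v₀).continuous
    let H : X × X → X → A := fun v ξ =>
      mul ((𝓕 φ : 𝓢(X, A)) ξ) (oscPh v • (χ (ε • (v - v₀)) • (oscPh (v.1, S.adjoint ξ) • g (T v.2))))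
    have hH : Integrable (Function.uncurry H) ((volume : Measure (X × X)).prod volume) := by
      have h1 : Integrable (fun v : X × X => ‖χ (ε • (v - v₀)) • g (T v.2)‖) volume :=
        ((hχc.smul (by fun_prop)).integrable_of_hasCompactSupport
          (hχ.compact_scale hε.ne' v₀).smul_right).norm
      have h2 : Integrable (fun ξ => ‖mul‖ * ‖(𝓕 φ : 𝓢(X, A)) ξ‖) volume := (𝓕 φ : 𝓢(X, A)).integrable.norm.const_mul _
      refine (h1.mul_prod h2).mono' (Continuous.aestronglyMeasurable ?_)
        (Eventually.of_forall fun w => ?_)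
      · refine (mul.continuous.comp (hφc.comp continuous_snd)).clm_apply ?_
        refine (hoc.comp continuous_fst).smul ((hχc.comp continuous_fst).smul ?_)
        refine (hoc.comp ?_).smul ?_ <;> fun_prop
      · refine (mul.le_opNorm₂ _ _).trans (le_of_eq ?_)
        rw [norm_smul, norm_smul, norm_smul, norm_smul, norm_oscPh, norm_oscPh]
        ring
    have h3 : ∀ ξ, mul ((𝓕 φ : 𝓢(X, A)) ξ) (cutT χ v₀ ε (fun v => oscPh (v.1, S.adjoint ξ) • g (T v.2)))
        = ∫ v, H v ξ := by
      intro ξ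
      rw [cutT, ← ContinuousLinearMap.integral_comp_comm]
      refine integrable_cutT hχ v₀ hε ?_
      refine (hoc.comp ?_).smul ?_ <;> fun_prop
    simp_rw [h3]
    rw [← integral_integral_swap hH, cutT]
    refine integral_congr_ae (Eventually.of_forall fun v => ?_)
    have h4 : Integrable (fun ξ => oscPh (v.1, S.adjoint ξ) • (𝓕 φ : 𝓢(X, A)) ξ) := by
      refine (𝓕 φ : 𝓢(X, A)).integrable.norm.mono' (Continuous.aestronglyMeasurable ?_)
        (Eventually.of_forall fun ξ => ?_)
      · refine (hoc.comp ?_).smul hφc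
        fun_prop
      · rw [norm_smul, norm_oscPh, one_mul]
    have h5 := (mul.flip (oscPh v • (χ (ε • (v - v₀)) • g (T v.2)))).integral_comp_comm h4
    rw [← SchwartzMap.eq_integral_oscPh] at h5
    simp only [ContinuousLinearMap.flip_apply] at h5
    have h6 : oscPh v • (χ (ε • (v - v₀)) • mul (φ (S v.1)) (g (T v.2)))
        = mul (φ (S v.1)) (oscPh v • (χ (ε • (v - v₀)) • g (T v.2))) := by
      rw [map_smul, ← Complex.coe_smul, ← Complex.coe_smul, map_smul]
    simp only [h6, ← h5]
    refine integral_congr_ae (Eventually.of_forall fun ξ => ?_)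
    simp only [H, ← Complex.coe_smul, map_smul, smul_apply, smul_smul]
    congr 1
    ring
  have hlim : Tendsto (fun ε : ℝ => ∫ ξ, mul ((𝓕 φ : 𝓢(X, A)) ξ)
      (cutT χ v₀ ε (fun v => oscPh (v.1, S.adjoint ξ) • g (T v.2))))
      (nhdsWithin 0 (Set.Ioi 0)) (nhds (∫ ξ, mul ((𝓕 φ : 𝓢(X, A)) ξ) (g (-(T.comp S.adjoint) ξ)))) := by
    obtain ⟨C, hC, h⟩ := exists_norm_cutT_modulate_le hχ hG
    refine tendsto_integral_filter_of_dominated_convergence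
      (fun ξ => (‖mul‖ * C * (1 + ‖S.adjoint‖) ^ s) * (‖(𝓕 φ : 𝓢(X, A)) ξ‖ * (1 + ‖ξ‖) ^ s)) ?_ ?_
      ((integrable_schwartz_mul_pow (𝓕 φ : 𝓢(X, A)) s).const_mul _) ?_
    · filter_upwards [self_mem_nhdsWithin] with ε hε
      have hε : 0 < ε := hε
      have hχc := (hχ.contDiff_scale ε v₀).continuous
      refine Continuous.aestronglyMeasurable ?_
      refine (mul.continuous.comp hφc).clm_apply ?_
      have h1 : Integrable (fun v : X × X => ‖χ (ε • (v - v₀)) • g (T v.2)‖) volume :=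
        ((hχc.smul (by fun_prop)).integrable_of_hasCompactSupport
          (hχ.compact_scale hε.ne' v₀).smul_right).norm
      refine continuous_of_dominated (fun ξ => Continuous.aestronglyMeasurable ?_)
        (fun ξ => Eventually.of_forall fun v => ?_) h1 (Eventually.of_forall fun v => ?_)
      · refine hoc.smul (hχc.smul ((hoc.comp ?_).smul ?_)) <;> fun_prop
      · rw [norm_smul, norm_smul, norm_smul, norm_smul, norm_oscPh, norm_oscPh]
        simp
      · refine continuous_const.smul (continuous_const.smul ((hoc.comp ?_).smul continuous_const))
        fun_prop
    · filter_upwards [self_mem_nhdsWithin, nhdsWithin_le_nhds (gt_mem_nhds one_pos)] with ε h0 h1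
      refine Eventually.of_forall fun ξ => (mul.le_opNorm₂ _ _).trans ?_
      have h2 : (1 + ‖S.adjoint ξ‖) ^ s ≤ (1 + ‖S.adjoint‖) ^ s * (1 + ‖ξ‖) ^ s := by
        rw [← mul_pow]
        gcongr
        nlinarith [S.adjoint.le_opNorm ξ, norm_nonneg ξ, norm_nonneg S.adjoint]
      calc ‖mul‖ * ‖(𝓕 φ : 𝓢(X, A)) ξ‖ * _ ≤ ‖mul‖ * ‖(𝓕 φ : 𝓢(X, A)) ξ‖ * (C * ((1 + ‖S.adjoint‖) ^ s * (1 + ‖ξ‖) ^ s)) := by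
            gcongr
            exact (h _ v₀ ε h0 (le_of_lt h1)).trans (by gcongr)
        _ = _ := by ring
    · refine Eventually.of_forall fun ξ => ?_
      have := tendsto_cutT_modulate hχ v₀ hG (S.adjoint ξ)
      rw [map_neg] at this
      exact ((mul ((𝓕 φ : 𝓢(X, A)) ξ)).continuous.tendsto _).comp this
  refine hlim.congr' ?_
  filter_upwards [self_mem_nhdsWithin] with ε hε
  exact (hform ε hε).symm

end SchwartzLimit

section Comparison

open scoped InnerProductSpace SchwartzMap

variable {X : Type*} [NormedAddCommGroup X] [InnerProductSpace ℝ X]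
  {A : Type*} [NormedAddCommGroup A] [NormedSpace ℂ A]

/-- A bilinear expression in two symbols evaluated on linear images of the two variables. -/
noncomputable def bilinSym (mul : A →L[ℂ] A →L[ℂ] A) (S T : X →L[ℝ] X) (f g : X → A) : X × X → A :=
  fun v => mul (f (S v.1)) (g (T v.2))

theorem contDiff_bilinSym (mul : A →L[ℂ] A →L[ℂ] A) (S T : X →L[ℝ] X) {f g : X → A}
    (hf : ContDiff ℝ (⊤ : ℕ∞) f) (hg : ContDiff ℝ (⊤ : ℕ∞) g) :
    ContDiff ℝ (⊤ : ℕ∞) (bilinSym mul S T f g) :=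
  (mul.bilinearRestrictScalars ℝ).isBoundedBilinearMap.contDiff.comp
    ((hf.comp (S.contDiff.comp contDiff_fst)).prodMk (hg.comp (T.contDiff.comp contDiff_snd)))

theorem exists_symBd_bilinSym (mul : A →L[ℂ] A →L[ℂ] A) (S T : X →L[ℝ] X) (s : ℕ) {t : ℕ}
    {g : X → A} (hg : IsSym t g) (K : ℕ) : ∃ C, 0 ≤ C ∧ ∀ (f : X → A) (R : ℝ),
      ContDiff ℝ (⊤ : ℕ∞) f → SymBd K s R f →
        SymBd K ((s + t : ℕ) : ℤ) (C * R) (bilinSym mul S T f g) := by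
  obtain ⟨c, hc⟩ := hg.bound K
  have hc0 := hc.nonneg
  let B := mul.bilinearRestrictScalars ℝ
  let S' := S.comp (ContinuousLinearMap.fst ℝ X X)
  let T' := T.comp (ContinuousLinearMap.snd ℝ X X)
  refine ⟨‖B‖ * (2 ^ K * ((1 + ‖S'‖) ^ (K + s) * ((1 + ‖T'‖) ^ (K + t) * c))), by positivity,
    fun f R hf hR => ?_⟩
  have h := SymBd.bilin B (hf.comp S'.contDiff) (hg.contDiff.comp T'.contDiff)
    (hR.comp_clm S' s hf) (hc.comp_clm T' t hg.contDiff)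
  push_cast
  exact h.mono le_rfl (le_of_eq (by ring))

variable [FiniteDimensional ℝ X] [MeasurableSpace X] [BorelSpace X]

theorem exists_norm_cutT_truncate_le (mul : A →L[ℂ] A →L[ℂ] A) (S T : X →L[ℝ] X) {b : X → ℝ}
    (hb : IsCut b) {χ : X × X → ℝ} (hχ : IsCut χ) {s t : ℕ} {f g : X → A}
    (hf : IsSym s f) (hg : IsSym t g) :
    ∃ C, 0 ≤ C ∧ ∀ δ, 0 < δ → δ ≤ 1 → ∀ v₀ ε, 0 < ε → ε ≤ 1 →
      ‖cutT χ v₀ ε (bilinSym mul S T f g)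
        - cutT χ v₀ ε (bilinSym mul S T (fun u => b (δ • u) • f u) g)‖ ≤ C * δ := by
  obtain ⟨K, C, hC, h⟩ := exists_norm_cutT_le (A := A) hχ (s + 1 + t)
  obtain ⟨C', hC', h'⟩ := exists_symBd_bilinSym mul S T (s + 1) hg K
  obtain ⟨c, hc⟩ := hf.bound K
  have hc0 := hc.nonneg
  obtain ⟨d, hd⟩ := SymBd.exists_of_hasCompactSupport hb.contDiff hb.compact K
  obtain ⟨r, hr, hr1⟩ := hb.exists_radius
  let D : X → ℝ := fun u => 1 + (-ContinuousLinearMap.id ℝ ℝ) (b u)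
  have hDs : ContDiff ℝ (⊤ : ℕ∞) D :=
    contDiff_const.add ((ContinuousLinearMap.contDiff _).comp hb.contDiff)
  obtain ⟨e, hD⟩ : ∃ e, SymBd K 0 e D := ⟨_, (SymBd.const (1 : ℝ)).add
    (SymBd.clm_comp (-ContinuousLinearMap.id ℝ ℝ) hb.contDiff hd) contDiff_const
    ((ContinuousLinearMap.contDiff _).comp hb.contDiff)⟩
  have he0 := hD.nonneg
  let B := ContinuousLinearMap.lsmul ℝ ℝ (E := A)
  refine ⟨C * (C' * (‖B‖ * (2 ^ K * (e / r * c)))), by positivity,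
    fun δ hδ hδ1 v₀ ε hε hε1 => ?_⟩
  let hδf : X → A := fun u => D (δ • (u - 0)) • f u
  have hDδ : ContDiff ℝ (⊤ : ℕ∞) (fun u => D (δ • (u - 0))) :=
    hDs.comp (contDiff_const.smul (contDiff_id.sub contDiff_const))
  have hsm : ContDiff ℝ (⊤ : ℕ∞) hδf := hDδ.smul hf.contDiff
  have h1 : SymBd K (0 + 1) (e / (r / δ)) (fun u => D (δ • (u - 0))) := by
    refine (hD.scale hδ.le hδ1 0 hDs).of_vanish (div_pos hr hδ) fun z hz => ?_
    rw [lt_div_iff₀ hδ] at hz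
    have := hr1 (δ • (z - 0)) (by
      rw [sub_zero, norm_smul, Real.norm_of_nonneg hδ.le]; linarith)
    simp only [D, this]
    simp
  have h2 : SymBd K ((s + 1 : ℕ) : ℤ) (‖B‖ * (2 ^ K * (e / (r / δ) * c))) hδf :=
    (SymBd.bilin B hDδ hf.contDiff h1 hc).mono (by push_cast; linarith) le_rfl
  have h3 : cutT χ v₀ ε (bilinSym mul S T f g)
      - cutT χ v₀ ε (bilinSym mul S T (fun u => b (δ • u) • f u) g)
      = cutT χ v₀ ε (bilinSym mul S T hδf g) := by
    have hbs : ContDiff ℝ (⊤ : ℕ∞) (fun u => b (δ • u) • f u) :=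
      (hb.contDiff.comp (contDiff_const.smul contDiff_id)).smul hf.contDiff
    rw [cutT, cutT, cutT, ← integral_sub
      (integrable_cutT hχ v₀ hε (contDiff_bilinSym mul S T hf.contDiff hg.contDiff).continuous)
      (integrable_cutT hχ v₀ hε (contDiff_bilinSym mul S T hbs hg.contDiff).continuous)]
    refine integral_congr_ae (Eventually.of_forall fun v => ?_)
    simp only [bilinSym, hδf, D, ← smul_sub]
    rw [← sub_apply, ← map_sub]
    simp [add_smul, sub_eq_add_neg]
  rw [h3]
  refine (h _ _ (contDiff_bilinSym mul S T hsm hg.contDiff) (h' hδf _ hsm h2) v₀ ε hε hε1).trans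
    (le_of_eq ?_)
  field_simp

/-- The oscillatory integral of `bilinSym mul S T f g` only depends on `T S†`. -/
theorem tendsto_cutT_bilinSym_sub [CompleteSpace A] (mul : A →L[ℂ] A →L[ℂ] A)
    {S T S' T' : X →L[ℝ] X} (hST : T.comp S.adjoint = T'.comp S'.adjoint)
    {χ χ' : X × X → ℝ} (hχ : IsCut χ) (hχ' : IsCut χ') (v₀ v₀' : X × X) {s t : ℕ} {f g : X → A}
    (hf : IsSym s f) (hg : IsSym t g) :
    Tendsto (fun ε => cutT χ v₀ ε (bilinSym mul S T f g)
      - cutT χ' v₀' ε (bilinSym mul S' T' f g)) (nhdsWithin 0 (Set.Ioi 0)) (nhds 0) := by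
  obtain ⟨b, hb⟩ := exists_isCut X
  obtain ⟨C, hC, h⟩ := exists_norm_cutT_truncate_le mul S T hb hχ hf hg
  obtain ⟨C', hC', h'⟩ := exists_norm_cutT_truncate_le mul S' T' hb hχ' hf hg
  rw [Metric.tendsto_nhds]
  intro η hη
  obtain ⟨δ, hδ, hδ1, hδC, hδC'⟩ : ∃ δ : ℝ, 0 < δ ∧ δ ≤ 1 ∧ C * δ < η / 3 ∧ C' * δ < η / 3 := by
    have hq : 0 < η / 3 / (C + C' + 1) := by positivity
    refine ⟨min 1 (η / 3 / (C + C' + 1)), lt_min one_pos hq, min_le_left _ _, ?_, ?_⟩ <;>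
    · have h1 := min_le_right 1 (η / 3 / (C + C' + 1))
      rw [le_div_iff₀ (by positivity)] at h1
      have h2 : 0 < min 1 (η / 3 / (C + C' + 1)) := lt_min one_pos hq
      nlinarith
  have hbδ : HasCompactSupport (fun u => b (δ • u)) :=
    hb.compact.comp_homeomorph (Homeomorph.smulOfNeZero δ hδ.ne')
  let φ : 𝓢(X, A) := HasCompactSupport.toSchwartzMap (f := fun u => b (δ • u) • f u)
    hbδ.smul_right ((hb.contDiff.comp (contDiff_const.smul contDiff_id)).smul hf.contDiff)
  have h1 := tendsto_cutT_schwartz mul φ S T hχ v₀ hg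
  have h2 := tendsto_cutT_schwartz mul φ S' T' hχ' v₀' hg
  rw [← hST] at h2
  have h3 := h1.sub h2
  rw [sub_self, Metric.tendsto_nhds] at h3
  filter_upwards [h3 (η / 3) (by positivity), self_mem_nhdsWithin,
    nhdsWithin_le_nhds (gt_mem_nhds one_pos)] with ε e3 h0 hε1
  have e1 := h δ hδ hδ1 v₀ ε h0 (le_of_lt hε1)
  have e2 := h' δ hδ hδ1 v₀' ε h0 (le_of_lt hε1)
  rw [dist_zero_right] at e3 ⊢
  have e4 : ∀ x y x' y' : A, x - y = (x - x') + (x' - y') - (y - y') := fun _ _ _ _ => by abel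
  rw [e4 _ _ (cutT χ v₀ ε (bilinSym mul S T (fun u => b (δ • u) • f u) g))
    (cutT χ' v₀' ε (bilinSym mul S' T' (fun u => b (δ • u) • f u) g))]
  refine (norm_sub_le _ _).trans_lt ?_
  refine (add_le_add_left (norm_add_le _ _) _).trans_lt ?_
  have e5 : ‖cutT χ v₀ ε (bilinSym mul S T (fun u => b (δ • u) • f u) g)
    - cutT χ' v₀' ε (bilinSym mul S' T' (fun u => b (δ • u) • f u) g)‖ < η / 3 := e3
  linarith

end Comparison

section Transfer

open scoped InnerProductSpace

variable {n : ℕ}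

/-- Concatenation of two vectors of `ℝⁿ`. -/
noncomputable def joinEquiv (n : ℕ) :
    (EuclideanSpace ℝ (Fin n) × EuclideanSpace ℝ (Fin n)) ≃L[ℝ] (Fin (n + n) → ℝ) :=
  LinearEquiv.toContinuousLinearEquiv
    { toFun := fun v => Fin.append v.1.ofLp v.2.ofLp
      invFun := fun z => (WithLp.toLp 2 (fstHalf z), WithLp.toLp 2 (sndHalf z))
      map_add' := fun v w => by
        ext i
        refine Fin.addCases (fun j => ?_) (fun j => ?_) i <;> simp [-Fin.natAdd_eq_addNat]
      map_smul' := fun c v => by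
        ext i
        refine Fin.addCases (fun j => ?_) (fun j => ?_) i <;> simp [-Fin.natAdd_eq_addNat]
      left_inv := fun v => by
        ext j <;> simp [fstHalf, sndHalf, -Fin.natAdd_eq_addNat]
      right_inv := fun z => by
        ext i
        refine Fin.addCases (fun j => ?_) (fun j => ?_) i <;>
          simp [fstHalf, sndHalf, -Fin.natAdd_eq_addNat] }

theorem joinEquiv_apply (v : EuclideanSpace ℝ (Fin n) × EuclideanSpace ℝ (Fin n)) :
    joinEquiv n v = Fin.append v.1.ofLp v.2.ofLp := rfl

theorem fstHalf_joinEquiv (v : EuclideanSpace ℝ (Fin n) × EuclideanSpace ℝ (Fin n)) :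
    fstHalf (joinEquiv n v) = v.1.ofLp := by
  ext i
  simp [fstHalf, joinEquiv_apply]

theorem sndHalf_joinEquiv (v : EuclideanSpace ℝ (Fin n) × EuclideanSpace ℝ (Fin n)) :
    sndHalf (joinEquiv n v) = v.2.ofLp := by
  ext i
  simp [sndHalf, joinEquiv_apply, -Fin.natAdd_eq_addNat]

theorem measurePreserving_joinEquiv : MeasurePreserving (joinEquiv n) := by
  have h1 : MeasurePreserving
      (Prod.map WithLp.ofLp WithLp.ofLp :
        EuclideanSpace ℝ (Fin n) × EuclideanSpace ℝ (Fin n) → (Fin n → ℝ) × (Fin n → ℝ)) :=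
    (PiLp.volume_preserving_ofLp (Fin n)).prod (PiLp.volume_preserving_ofLp (Fin n))
  have h2 := volume_measurePreserving_sumPiEquivProdPi_symm (fun _ : Fin n ⊕ Fin n => ℝ)
  have h3 := volume_measurePreserving_piCongrLeft (fun _ : Fin (n + n) => ℝ)
    (finSumFinEquiv (m := n) (n := n))
  have h4 := h3.comp (h2.comp h1)
  suffices h : (joinEquiv n : _ → Fin (n + n) → ℝ) = _ by
    rw [h]
    exact h4
  funext v
  ext i
  refine Fin.addCases (fun j => ?_) (fun j => ?_) i
  · have := MeasurableEquiv.piCongrLeft_apply_apply (β := fun _ : Fin (n + n) => ℝ)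
      (finSumFinEquiv (m := n) (n := n))
      ((MeasurableEquiv.sumPiEquivProdPi (fun _ : Fin n ⊕ Fin n => ℝ)).symm
        (v.1.ofLp, v.2.ofLp)) (Sum.inl j)
    simp only [finSumFinEquiv_apply_left] at this
    simp only [Function.comp_apply, Prod.map, this, joinEquiv_apply, Fin.append_left]
    rfl
  · have := MeasurableEquiv.piCongrLeft_apply_apply (β := fun _ : Fin (n + n) => ℝ)
      (finSumFinEquiv (m := n) (n := n))
      ((MeasurableEquiv.sumPiEquivProdPi (fun _ : Fin n ⊕ Fin n => ℝ)).symm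
        (v.1.ofLp, v.2.ofLp)) (Sum.inr j)
    simp only [finSumFinEquiv_apply_right] at this
    simp only [Function.comp_apply, Prod.map, this, joinEquiv_apply, Fin.append_right]
    rfl

theorem integral_joinEquiv {V : Type*} [NormedAddCommGroup V] [NormedSpace ℝ V]
    (H : (Fin (n + n) → ℝ) → V) : ∫ v, H (joinEquiv n v) = ∫ z, H z :=
  measurePreserving_joinEquiv.integral_comp
    (joinEquiv n).toHomeomorph.measurableEmbedding H

theorem integral_comp_continuousLinearEquiv {E V : Type*} [NormedAddCommGroup E]
    [NormedSpace ℝ E] [FiniteDimensional ℝ E] [MeasurableSpace E] [BorelSpace E] (μ : Measure E)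
    [μ.IsAddHaarMeasure] [NormedAddCommGroup V] [NormedSpace ℝ V] (L : E ≃L[ℝ] E) (H : E → V) :
    |LinearMap.det (L : E →ₗ[ℝ] E)| • ∫ v, H (L v) ∂μ = ∫ v, H v ∂μ := by
  have hdet : LinearMap.det (L : E →ₗ[ℝ] E) ≠ 0 := (LinearEquiv.isUnit_det' L.toLinearEquiv).ne_zero
  have h1 := Measure.map_linearMap_addHaar_eq_smul_addHaar μ hdet
  have h2 : ∫ v, H (L v) ∂μ = ∫ v, H v ∂(μ.map L) :=
    (L.toHomeomorph.measurableEmbedding.integral_map H).symm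
  have h3 : μ.map L = μ.map (L : E →ₗ[ℝ] E) := rfl
  rw [h2, h3, h1, integral_smul_measure, ENNReal.toReal_ofReal (abs_nonneg _), smul_smul, abs_inv,
    mul_inv_cancel₀ (abs_ne_zero.2 hdet), one_smul]

/-- The regularized integral in the coordinates `p = P p'`, `x = Q x'` in which the phase is
standard. -/
theorem exists_cutInt_eq_cutT (A : Type*) [NormedAddCommGroup A] [NormedSpace ℂ A]
    (M P Q : Matrix (Fin n) (Fin n) ℝ) (hM : |M.det| = 1)
    (hPQ : P.transpose * M * Q = (2 * Real.pi) • 1)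
    {χ : (Fin (n + n) → ℝ) → ℝ} (hχ : IsCut χ) (z₀ : Fin (n + n) → ℝ) :
    ∃ (χ' : EuclideanSpace ℝ (Fin n) × EuclideanSpace ℝ (Fin n) → ℝ)
      (v₀ : EuclideanSpace ℝ (Fin n) × EuclideanSpace ℝ (Fin n)), IsCut χ' ∧
      ∀ (ε : ℝ) (F : (Fin (n + n) → ℝ) → A), cutInt M χ z₀ ε F = cutT χ' v₀ ε (fun v =>
          F (Fin.append (P.mulVec v.1.ofLp) (Q.mulVec v.2.ofLp))) := by
  let X := EuclideanSpace ℝ (Fin n)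
  have hdet : P.det * M.det * Q.det = (2 * Real.pi) ^ n := by
    rw [← P.det_transpose, ← Matrix.det_mul, ← Matrix.det_mul, hPQ, Matrix.det_smul]
    simp
  have hdet' : |P.det * Q.det| = (2 * Real.pi) ^ n := by
    rw [← abs_of_pos (show 0 < (2 * Real.pi) ^ n by positivity), ← hdet, abs_mul, abs_mul, abs_mul,
      hM, mul_one]
  let D : X × X →ₗ[ℝ] X × X := (Matrix.toLpLin 2 2 P).prodMap (Matrix.toLpLin 2 2 Q)
  have hD : LinearMap.det D = P.det * Q.det := by
    simp only [D]
    rw [LinearMap.det_prodMap, LinearMap.det_toLpLin, LinearMap.det_toLpLin]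
  have hD0 : LinearMap.det D ≠ 0 := by
    rw [hD, ← abs_ne_zero, hdet']
    positivity
  let D' : (X × X) ≃L[ℝ] X × X := (D.equivOfDetNeZero hD0).toContinuousLinearEquiv
  have hDD : (D' : X × X →ₗ[ℝ] X × X) = D := by
    ext <;> rfl
  let L := D'.trans (joinEquiv n)
  have hph : ∀ v, phase M (L v) = oscPh v := by
    intro v
    have h1 : fstHalf (L v) = P.mulVec v.1.ofLp := fstHalf_joinEquiv _
    have h2 : sndHalf (L v) = Q.mulVec v.2.ofLp := sndHalf_joinEquiv _
    have h3 : pairM M (fstHalf (L v)) (sndHalf (L v)) = 2 * Real.pi * ⟪v.1, v.2⟫_ℝ := by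
      rw [h1, h2]
      change (P.mulVec v.1.ofLp) ⬝ᵥ (M.mulVec (Q.mulVec v.2.ofLp)) = _
      rw [← Matrix.vecMul_transpose, ← Matrix.dotProduct_mulVec, Matrix.mulVec_mulVec,
        Matrix.mulVec_mulVec, hPQ, Matrix.smul_mulVec, Matrix.one_mulVec,
        dotProduct_smul, smul_eq_mul, EuclideanSpace.inner_eq_star_dotProduct, dotProduct_comm]
      simp
    rw [phase, h3, oscPh, mul_comm]
  refine ⟨fun v => χ (L v), L.symm z₀, ⟨hχ.contDiff.comp L.contDiff,
    hχ.compact.comp_homeomorph L.toHomeomorph, ?_⟩, fun ε F => ?_⟩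
  · have : Tendsto L (nhds 0) (nhds 0) := by simpa using L.continuous.tendsto 0
    exact this.eventually hχ.one
  · have : (volume : Measure (X × X)).IsAddHaarMeasure :=
      inferInstanceAs ((volume : Measure X).prod volume).IsAddHaarMeasure
    rw [cutInt, ← integral_joinEquiv, ← integral_comp_continuousLinearEquiv volume D', hDD, hD,
      hdet', inv_smul_smul₀ (by positivity), cutT]
    refine integral_congr_ae (Eventually.of_forall fun v => ?_)
    change χ (ε • (L v - z₀)) • (phase M (L v) • F (L v))
      = oscPh v • (χ (L (ε • (v - L.symm z₀))) • F (L v))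
    rw [hph, smul_comm, map_smul, map_sub, L.apply_symm_apply]

end Transfer

section Deformation

theorem cutT_swap (A : Type*) [NormedAddCommGroup A] [NormedSpace ℂ A]
    {X : Type*} [NormedAddCommGroup X] [InnerProductSpace ℝ X]
    [FiniteDimensional ℝ X] [MeasurableSpace X] [BorelSpace X] {χ : X × X → ℝ} (hχ : IsCut χ)
    (v₀ : X × X) : ∃ (χ' : X × X → ℝ) (v₀' : X × X), IsCut χ' ∧
      ∀ (ε : ℝ) (F : X × X → A),
        cutT χ v₀ ε (fun v => F v.swap) = cutT χ' v₀' ε F := by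
  let L := ContinuousLinearEquiv.prodComm ℝ X X
  refine ⟨fun v => χ v.swap, v₀.swap, ⟨hχ.contDiff.comp L.contDiff,
    hχ.compact.comp_homeomorph L.toHomeomorph, ?_⟩, fun ε F => ?_⟩
  · have : Tendsto L (nhds 0) (nhds 0) := by simpa using L.continuous.tendsto 0
    exact this.eventually hχ.one
  · have h := integral_prod_swap (μ := (volume : Measure X)) (ν := (volume : Measure X))
      (fun v => oscPh v • (χ ((ε • (v - v₀.swap)).swap) • F v))
    refine Eq.trans (integral_congr_ae (Eventually.of_forall fun v => ?_)) h
    have h1 : oscPh v.swap = oscPh v := by simp [oscPh, real_inner_comm]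
    simp [h1]

theorem mder_zero {n : ℕ} {V : Type*} [NormedAddCommGroup V] [NormedSpace ℝ V]
    (f : (Fin n → ℝ) → V) : mder 0 f = f := by
  have : ∀ l : List (Fin n), l.foldr (fun i g => (pder i)^[(0 : Fin n → ℕ) i] g) f = f := by
    intro l
    induction l with
    | nil => rfl
    | cons i l ih => simp
  exact this _

theorem isSym_of_action {n : ℕ} {A : Type*} [NormedAddCommGroup A] [NormedSpace ℂ A]
    {m : ℝ} (hm : 0 ≤ m) {α : (Fin n → ℝ) → A →L[ℂ] A}
    (hαadd : ∀ x x' : Fin n → ℝ, α (x + x') = (α x).comp (α x'))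
    (hαsmooth : ∀ a : A, ContDiff ℝ (⊤ : ℕ∞) (fun x => α x a))
    {C : ℝ} (hC : 0 ≤ C)
    (hαbound : ∀ (x : Fin n → ℝ) (a : A), ‖α x a‖ ≤ C * (1 + ‖x‖ ^ 2) ^ (m / 2) * ‖a‖) (a : A) :
    IsSym ⌈m⌉₊ (fun u : EuclideanSpace ℝ (Fin n) => α u.ofLp a) := by
  let X := EuclideanSpace ℝ (Fin n)
  have hs : ContDiff ℝ (⊤ : ℕ∞) (fun u : X => α u.ofLp a) :=
    (hαsmooth a).comp (EuclideanSpace.equiv (Fin n) ℝ).contDiff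
  have hop : ∀ z : X, ‖α z.ofLp‖ ≤ C * (1 + ‖z‖) ^ ⌈m⌉₊ := by
    intro z
    refine ContinuousLinearMap.opNorm_le_bound _ (by positivity) fun w => ?_
    refine (hαbound _ _).trans ?_
    have h1 : ‖z.ofLp‖ ≤ ‖z‖ :=
      (pi_norm_le_iff_of_nonneg (norm_nonneg z)).2 fun i => PiLp.norm_apply_le z i
    have h2 : (1 + ‖z.ofLp‖ ^ 2) ^ (m / 2) ≤ (1 + ‖z‖) ^ ⌈m⌉₊ := by
      calc (1 + ‖z.ofLp‖ ^ 2) ^ (m / 2) ≤ ((1 + ‖z‖) ^ 2) ^ (m / 2) := by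
            gcongr
            nlinarith [norm_nonneg z, norm_nonneg z.ofLp]
        _ = (1 + ‖z‖) ^ m := by
            rw [← Real.rpow_natCast, ← Real.rpow_mul (by positivity)]
            congr 1
            push_cast
            ring
        _ ≤ (1 + ‖z‖) ^ (⌈m⌉₊ : ℝ) :=
            Real.rpow_le_rpow_of_exponent_le (by linarith [norm_nonneg z]) (Nat.le_ceil m)
        _ = _ := Real.rpow_natCast _ _
    gcongr
  refine ⟨hs, fun K => ?_⟩
  let f : X → A := fun u => α u.ofLp a
  refine ⟨C * ∑ k ∈ Finset.range (K + 1), ‖iteratedFDeriv ℝ k f 0‖, fun k hk z => ?_⟩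
  have h1 : iteratedFDeriv ℝ k f z
      = iteratedFDeriv ℝ k (((α z.ofLp).restrictScalars ℝ : A →L[ℝ] A) ∘ f) 0 := by
    have h2 : (((α z.ofLp).restrictScalars ℝ : A →L[ℝ] A) ∘ f) = fun u => f (u + z) := by
      funext u
      change α z.ofLp (α u.ofLp a) = α (u.ofLp + z.ofLp) a
      rw [add_comm, hαadd]
      rfl
    rw [h2, iteratedFDeriv_comp_add_right, zero_add]
  change ‖iteratedFDeriv ℝ k f z‖ ≤ _
  rw [h1]
  refine (ContinuousLinearMap.norm_iteratedFDeriv_comp_left _ hs.contDiffAt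
    (by exact_mod_cast le_top : (k : WithTop ℕ∞) ≤ _)).trans ?_
  have h3 : ‖iteratedFDeriv ℝ k f 0‖ ≤ ∑ k ∈ Finset.range (K + 1), ‖iteratedFDeriv ℝ k f 0‖ :=
    Finset.single_le_sum (f := fun k => ‖iteratedFDeriv ℝ k f 0‖) (fun _ _ => norm_nonneg _)
      (Finset.mem_range.2 (by omega))
  rw [ContinuousLinearMap.norm_restrictScalars, zpow_natCast]
  calc _ ≤ (C * (1 + ‖z‖) ^ ⌈m⌉₊) * ∑ k ∈ Finset.range (K + 1), ‖iteratedFDeriv ℝ k f 0‖ := by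
        gcongr
        exact hop z
    _ = _ := by ring

variable {n : ℕ} {A : Type*} [NormedAddCommGroup A] [NormedSpace ℂ A]

theorem IsOscInt.unique {M : Matrix (Fin n) (Fin n) ℝ} {F : (Fin (n + n) → ℝ) → A} {v w : A}
    (hv : IsOscInt M F v) (hw : IsOscInt M F w) : v = w := by
  obtain ⟨χ, hχ⟩ := exists_isCut (Fin (n + n) → ℝ)
  exact tendsto_nhds_unique (hv χ hχ.contDiff hχ.compact hχ.one 0)
    (hw χ hχ.contDiff hχ.compact hχ.one 0)

theorem IsOscInt.oscInt_eq {M : Matrix (Fin n) (Fin n) ℝ} {F : (Fin (n + n) → ℝ) → A} {v : A}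
    (hv : IsOscInt M F v) : oscInt M F = v := by
  have h : ∃ v, IsOscInt M F v := ⟨v, hv⟩
  rw [oscInt, dif_pos h]
  exact h.choose_spec.unique hv

theorem oscInt_eq_zero {M : Matrix (Fin n) (Fin n) ℝ} {F : (Fin (n + n) → ℝ) → A}
    (h : ¬∃ v, IsOscInt M F v) : oscInt M F = 0 := dif_neg h

theorem phase_neg (M : Matrix (Fin n) (Fin n) ℝ) (z : Fin (n + n) → ℝ) :
    phase (-M) z = (starRingEnd ℂ) (phase M z) := by
  rw [phase, phase, ← Complex.exp_conj]
  simp [pairM, Matrix.neg_mulVec]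

theorem transpose_mul_eq_neg {M θ : Matrix (Fin n) (Fin n) ℝ}
    (h : ∀ p p' : Fin n → ℝ, pairM M p (θ.mulVec p') = -pairM M p' (θ.mulVec p)) :
    (M * θ).transpose = -(M * θ) := by
  ext i j
  have h1 := h (Pi.single j 1) (Pi.single i 1)
  have h2 : ∀ p x, pairM M p (θ.mulVec x) = p ⬝ᵥ (M * θ).mulVec x := fun p x => by
    rw [← Matrix.mulVec_mulVec]
    rfl
  rw [h2, h2] at h1
  simpa using h1

/-- An additive, conjugate-linear, continuous involution as a real continuous linear
equivalence. -/
noncomputable def involutionEquiv (st : A → A) (hstcont : Continuous st)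
    (hstinv : ∀ a : A, st (st a) = a) (hstadd : ∀ a b : A, st (a + b) = st a + st b)
    (hstsmul : ∀ (c : ℂ) (a : A), st (c • a) = (starRingEnd ℂ) c • st a) : A ≃L[ℝ] A where
  toFun := st
  invFun := st
  map_add' := hstadd
  map_smul' r a := by
    have h := hstsmul (r : ℂ) a
    rwa [Complex.conj_ofReal, Complex.coe_smul, Complex.coe_smul] at h
  left_inv := hstinv
  right_inv := hstinv
  continuous_toFun := hstcont
  continuous_invFun := hstcont

theorem involution_cutInt (E : A ≃L[ℝ] A)
    (hE : ∀ (c : ℂ) (a : A), E (c • a) = (starRingEnd ℂ) c • E a)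
    (M : Matrix (Fin n) (Fin n) ℝ) (χ : (Fin (n + n) → ℝ) → ℝ) (z₀ : Fin (n + n) → ℝ) (ε : ℝ)
    (F : (Fin (n + n) → ℝ) → A) :
    E (cutInt M χ z₀ ε F) = cutInt (-M) χ z₀ ε (fun z => E (F z)) := by
  rw [cutInt, cutInt, map_smul, ← ContinuousLinearEquiv.integral_comp_comm]
  simp_rw [map_smul, hE, phase_neg]

variable {M : Matrix (Fin n) (Fin n) ℝ} {χ : (Fin (n + n) → ℝ) → ℝ}

theorem exists_cutInt_eq_cutT_fst (A : Type*) [NormedAddCommGroup A] [NormedSpace ℂ A]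
    (hM : |M.det| = 1) (hχ : IsCut χ) (z₀ : Fin (n + n) → ℝ) :
    ∃ (χ' : EuclideanSpace ℝ (Fin n) × EuclideanSpace ℝ (Fin n) → ℝ)
      (v₀ : EuclideanSpace ℝ (Fin n) × EuclideanSpace ℝ (Fin n)), IsCut χ' ∧
      ∀ (ε : ℝ) (F : (Fin (n + n) → ℝ) → A), cutInt M χ z₀ ε F = cutT χ' v₀ ε (fun v =>
          F (Fin.append (((2 * Real.pi) • 1 : Matrix (Fin n) (Fin n) ℝ).mulVec v.1.ofLp)
            (M⁻¹.mulVec v.2.ofLp))) := by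
  have hu : IsUnit M.det := by
    rw [isUnit_iff_ne_zero, ← abs_ne_zero, hM]
    exact one_ne_zero
  refine exists_cutInt_eq_cutT A M _ _ hM ?_ hχ z₀
  rw [mul_assoc, Matrix.mul_nonsing_inv _ hu]
  simp

theorem exists_cutInt_eq_cutT_snd (A : Type*) [NormedAddCommGroup A] [NormedSpace ℂ A]
    (hM : |M.det| = 1) (hχ : IsCut χ) (z₀ : Fin (n + n) → ℝ) :
    ∃ (χ' : EuclideanSpace ℝ (Fin n) × EuclideanSpace ℝ (Fin n) → ℝ)
      (v₀ : EuclideanSpace ℝ (Fin n) × EuclideanSpace ℝ (Fin n)), IsCut χ' ∧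
      ∀ (ε : ℝ) (F : (Fin (n + n) → ℝ) → A), cutInt M χ z₀ ε F = cutT χ' v₀ ε (fun v =>
          F (Fin.append (M⁻¹.transpose.mulVec v.2.ofLp)
            (((2 * Real.pi) • 1 : Matrix (Fin n) (Fin n) ℝ).mulVec v.1.ofLp))) := by
  have hu : IsUnit M.det := by
    rw [isUnit_iff_ne_zero, ← abs_ne_zero, hM]
    exact one_ne_zero
  obtain ⟨χ₁, v₁, hχ₁, h₁⟩ := exists_cutInt_eq_cutT A M M⁻¹.transpose ((2 * Real.pi) • 1) hM
    (by rw [Matrix.transpose_transpose, Matrix.nonsing_inv_mul _ hu, one_mul]) hχ z₀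
  obtain ⟨χ₂, v₂, hχ₂, h₂⟩ := cutT_swap A hχ₁ v₁
  refine ⟨χ₂, v₂, hχ₂, fun ε F => ?_⟩
  rw [h₁, ← h₂]
  rfl

variable [CompleteSpace A]

theorem isOscInt_of_snd (hM : |M.det| = 1) {s : ℕ} {g : EuclideanSpace ℝ (Fin n) → A}
    (hg : IsSym s g) : IsOscInt M (fun z => g (WithLp.toLp 2 (sndHalf z))) (g 0) := by
  intro χ h1 h2 h3 z₀
  obtain ⟨χ', v₀, hχ', h⟩ := exists_cutInt_eq_cutT_fst A hM ⟨h1, h2, h3⟩ z₀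
  have hg' := tendsto_cutT_snd hχ' v₀ (hg.comp_clm (Matrix.toEuclideanCLM (𝕜 := ℝ) M⁻¹))
  rw [map_zero] at hg'
  simp_rw [h]
  convert hg' using 5 with ε v
  ext i
  simp [sndHalf, -Fin.natAdd_eq_addNat]

theorem isOscInt_of_fst (hM : |M.det| = 1) {s : ℕ} {g : EuclideanSpace ℝ (Fin n) → A}
    (hg : IsSym s g) : IsOscInt M (fun z => g (WithLp.toLp 2 (fstHalf z))) (g 0) := by
  intro χ h1 h2 h3 z₀
  obtain ⟨χ', v₀, hχ', h⟩ := exists_cutInt_eq_cutT_snd A hM ⟨h1, h2, h3⟩ z₀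
  have hg' := tendsto_cutT_snd hχ' v₀ (hg.comp_clm (Matrix.toEuclideanCLM (𝕜 := ℝ) M⁻¹.transpose))
  rw [map_zero] at hg'
  simp_rw [h]
  convert hg' using 5 with ε v
  ext i
  simp [fstHalf]

theorem fstHalf_append (x y : Fin n → ℝ) : fstHalf (Fin.append x y) = x := by
  ext i
  simp [fstHalf]

theorem sndHalf_append (x y : Fin n → ℝ) : sndHalf (Fin.append x y) = y := by
  ext i
  simp [sndHalf, -Fin.natAdd_eq_addNat]

/-- Exchanging the two arguments of a bilinear symbol and conjugating the phase does not change
the oscillatory integral when `θ` is skew-symmetric with respect to the pairing. -/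
theorem tendsto_cutInt_neg_sub (hM : |M.det| = 1) {θ : Matrix (Fin n) (Fin n) ℝ}
    (hθ : (M * θ).transpose = -(M * θ)) (mul : A →L[ℂ] A →L[ℂ] A) {s t : ℕ}
    {f g : (Fin n → ℝ) → A} (hf : IsSym s (fun u : EuclideanSpace ℝ (Fin n) => f u.ofLp))
    (hg : IsSym t (fun u : EuclideanSpace ℝ (Fin n) => g u.ofLp)) (hχ : IsCut χ)
    (z₀ : Fin (n + n) → ℝ) :
    Tendsto (fun ε =>
      cutInt (-M) χ z₀ ε (fun z => mul (f (sndHalf z)) (g (θ.mulVec (fstHalf z))))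
        - cutInt M χ z₀ ε (fun z => mul (f (θ.mulVec (fstHalf z))) (g (sndHalf z))))
      (nhdsWithin 0 (Set.Ioi 0)) (nhds 0) := by
  have hu : IsUnit M.det := by
    rw [isUnit_iff_ne_zero, ← abs_ne_zero, hM]
    exact one_ne_zero
  have hM' : |(-M).det| = 1 := by rw [Matrix.det_neg]; simp [abs_mul, hM]
  obtain ⟨χ₁, v₁, hχ₁, h₁⟩ := exists_cutInt_eq_cutT_snd A hM' hχ z₀
  obtain ⟨χ₂, v₂, hχ₂, h₂⟩ := exists_cutInt_eq_cutT_fst A hM hχ z₀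
  let c : Matrix (Fin n) (Fin n) ℝ := (2 * Real.pi) • 1
  let Λ (N : Matrix (Fin n) (Fin n) ℝ) := Matrix.toEuclideanCLM (𝕜 := ℝ) N
  have hST : (Λ (θ * (-M)⁻¹.transpose)).comp (Λ c).adjoint = (Λ M⁻¹).comp (Λ (θ * c)).adjoint := by
    rw [← ContinuousLinearMap.star_eq_adjoint, ← ContinuousLinearMap.star_eq_adjoint]
    change Λ _ * star (Λ _) = Λ _ * star (Λ _)
    simp only [Λ, ← map_star, ← map_mul]
    congr 1
    have e1 : (-M)⁻¹ = -M⁻¹ := Matrix.inv_eq_right_inv (by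
      rw [neg_mul_neg, Matrix.mul_nonsing_inv _ hu])
    have e2 : M⁻¹ * θ.transpose = -(θ * M⁻¹.transpose) := by
      have e3 : M⁻¹.transpose = M.transpose⁻¹ := Matrix.transpose_nonsing_inv M
      have hu' : IsUnit M.transpose.det := by rwa [Matrix.det_transpose]
      rw [Matrix.transpose_mul] at hθ
      calc M⁻¹ * θ.transpose = M⁻¹ * (θ.transpose * M.transpose) * M.transpose⁻¹ := by
            rw [mul_assoc, mul_assoc, Matrix.mul_nonsing_inv _ hu', mul_one]
        _ = -(θ * M⁻¹.transpose) := by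
            rw [hθ, mul_neg, neg_mul, ← mul_assoc, Matrix.nonsing_inv_mul _ hu, one_mul, e3]
    rw [e1, star_mul]
    simp only [c, Matrix.star_eq_conjTranspose, Matrix.conjTranspose_eq_transpose_of_trivial,
      Matrix.transpose_smul, Matrix.transpose_one, smul_mul_assoc, mul_smul_comm, one_mul, mul_one,
      e2, Matrix.transpose_neg, mul_neg]
  have key := tendsto_cutT_bilinSym_sub mul hST hχ₁ hχ₂ v₁ v₂ hf hg
  simp_rw [h₁, h₂]
  convert key using 5 with ε
  · simp only [fstHalf_append, sndHalf_append, bilinSym, Λ, Matrix.ofLp_toEuclideanCLM,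
      Matrix.mulVec_mulVec, c]
  · simp only [fstHalf_append, sndHalf_append, bilinSym, Λ, Matrix.ofLp_toEuclideanCLM,
      Matrix.mulVec_mulVec, c]

theorem normedSpace_real_eq {B : Type*} [NormedAddCommGroup B] (i : NormedSpace ℝ B)
    [NormedSpace ℂ B] [IsScalarTower ℝ ℂ B] : i = NormedSpace.complexToReal := by
  ext r x
  change r • x = (r : ℂ) • x
  rw [← one_smul ℂ x, ← smul_assoc, ← smul_assoc]
  simp

end Deformation

theorem statement17 {n : ℕ} {A : Type*} [NormedAddCommGroup A] [NormedSpace ℝ A]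
    [NormedSpace ℂ A] [IsScalarTower ℝ ℂ A] [CompleteSpace A]
    (M : Matrix (Fin n) (Fin n) ℝ) (hM : |M.det| = 1)
    (mul : A →L[ℂ] A →L[ℂ] A) (C₀ : ℝ) (hC₀ : 0 < C₀)
    (hmulbound : ∀ a b : A, ‖mul a b‖ ≤ C₀ * ‖a‖ * ‖b‖)
    (hassoc : ∀ a b c : A, mul (mul a b) c = mul a (mul b c))
    (m : ℝ) (hm : 0 ≤ m)
    (α : (Fin n → ℝ) → A →L[ℂ] A)
    (hα0 : α 0 = ContinuousLinearMap.id ℂ A)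
    (hαadd : ∀ x x' : Fin n → ℝ, α (x + x') = (α x).comp (α x'))
    (hαmul : ∀ (x : Fin n → ℝ) (a b : A), α x (mul a b) = mul (α x a) (α x b))
    (hαsmooth : ∀ a : A, ContDiff ℝ (⊤ : ℕ∞) (fun x => α x a))
    (hαbound : ∀ μ : Fin n → ℕ, ∃ C : ℝ, 0 < C ∧ ∀ (x : Fin n → ℝ) (a : A),
      ‖mder μ (fun x' => α x' a) x‖ ≤ C * (1 + ‖x‖ ^ 2) ^ (m / 2) * ‖a‖)
    (e : A) (he1 : ∀ a : A, mul e a = a) (he2 : ∀ a : A, mul a e = a)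
    (st : A → A) (hstcont : Continuous st) (hstinv : ∀ a : A, st (st a) = a)
    (hstadd : ∀ a b : A, st (a + b) = st a + st b)
    (hstsmul : ∀ (c : ℂ) (a : A), st (c • a) = (starRingEnd ℂ) c • st a)
    (hstmul : ∀ a b : A, st (mul a b) = mul (st b) (st a))
    (hαe : ∀ x : Fin n → ℝ, α x e = e)
    (hαst : ∀ (x : Fin n → ℝ) (a : A), α x (st a) = st (α x a))
    (θ : Matrix (Fin n) (Fin n) ℝ) :
    (∀ a : A, defProd M θ mul α e a = a ∧ defProd M θ mul α a e = a) ∧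
    ((∀ p p' : Fin n → ℝ, pairM M p (θ.mulVec p') = - pairM M p' (θ.mulVec p)) →
      ∀ a b : A, st (defProd M θ mul α a b) = defProd M θ mul α (st b) (st a)) := by
  rename_i iR _ _ _
  obtain rfl := normedSpace_real_eq iR
  obtain ⟨C, hC, hαb⟩ := hαbound 0
  simp only [mder_zero] at hαb
  have hsym := isSym_of_action hm hαadd hαsmooth hC.le hαb
  have hsymθ : ∀ a, IsSym ⌈m⌉₊ (fun u : EuclideanSpace ℝ (Fin n) => α (θ.mulVec u.ofLp) a) :=
    fun a => (hsym a).comp_clm (Matrix.toEuclideanCLM (𝕜 := ℝ) θ)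
  refine ⟨fun a => ⟨?_, ?_⟩, fun hθ a b => ?_⟩
  · refine IsOscInt.oscInt_eq ?_
    simp only [hαe, he1]
    simpa [hα0] using isOscInt_of_snd hM (hsym a)
  · refine IsOscInt.oscInt_eq ?_
    simp only [hαe, he2]
    simpa [hα0] using isOscInt_of_fst hM (hsymθ a)
  · let E := involutionEquiv st hstcont hstinv hstadd hstsmul
    have hE : ∀ x, E x = st x := fun _ => rfl
    have key : ∀ a b v, IsOscInt M (fun z : Fin (n + n) → ℝ =>
        mul (α (θ.mulVec (fstHalf z)) a) (α (sndHalf z) b)) v →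
        IsOscInt M (fun z : Fin (n + n) → ℝ =>
          mul (α (θ.mulVec (fstHalf z)) (st b)) (α (sndHalf z) (st a))) (st v) := by
      intro a b v hv χ h1 h2 h3 z₀
      have hd := tendsto_cutInt_neg_sub hM (transpose_mul_eq_neg hθ) mul (f := fun x => α x (st b))
        (g := fun x => α x (st a)) (hsym (st b))
        (hsym (st a)) ⟨h1, h2, h3⟩ z₀
      have hl := (E.continuous.tendsto v).comp (hv χ h1 h2 h3 z₀)
      have hs := hl.sub hd
      rw [sub_zero] at hs
      refine hs.congr fun ε => ?_
      rw [Function.comp_apply, involution_cutInt E hstsmul]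
      simp only [hE, hstmul, ← hαst, sub_sub_cancel]
    rw [defProd, defProd]
    by_cases h : ∃ v, IsOscInt M (fun z : Fin (n + n) → ℝ =>
        mul (α (θ.mulVec (fstHalf z)) a) (α (sndHalf z) b)) v
    · obtain ⟨v, hv⟩ := h
      rw [hv.oscInt_eq, (key a b v hv).oscInt_eq]
    · rw [oscInt_eq_zero h, oscInt_eq_zero, ← hE, map_zero]
      rintro ⟨v, hv⟩
      have := key _ _ _ hv
      rw [hstinv, hstinv] at this
      exact h ⟨_, this⟩
end

section
/- There exists a smooth function τ : ℝ × ℝ → ℝ such that: (i) τ is an ℝ-action, i.e. τ(0,y) = y and τ(x, τ(x',y)) = τ(x+x', y) for all x, x', y ∈ ℝ; (ii) τ has support in [−1,1], i.e. τ(x,y) = y for all x ∈ ℝ and all y with |y| ≥ 1; (iii) τ is polynomially bounded of order b_l = 2l+1: for all k, l ∈ ℕ there is a constant c_{lk} > 0 such that sup_{|y|≤1} |∂_x^k ∂_y^l τ(x,y)| ≤ c_{lk} (1+x²)^{(2l+1)/2} for all x ∈ ℝ; and (iv) τ acts transitively on (−1,1): for every y ∈ (−1,1), the orbit {τ(x,y)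 : x ∈ ℝ} equals (−1,1). -/
namespace TransitiveFlow

open Set

/-- The time coordinate `(-1, 1) → ℝ` of the flow. -/
noncomputable def time (y : ℝ) : ℝ := Real.exp (1 - y)⁻¹ - Real.exp (1 + y)⁻¹

/-- The derivative of `time` on `(-1, 1)`. -/
noncomputable def slope (y : ℝ) : ℝ :=
  (1 - y)⁻¹ * (1 - y)⁻¹ * Real.exp (1 - y)⁻¹ + (1 + y)⁻¹ * (1 + y)⁻¹ * Real.exp (1 + y)⁻¹

/-- The velocity field of the flow on `(-1, 1)`. -/
noncomputable def vel (y : ℝ) : ℝ := (slope y)⁻¹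

/-- The weight measuring the growth of symbols. -/
noncomputable def weight (y : ℝ) : ℝ := 1 + |time y|

/-- Symbols of order `a` on `(-1, 1)`: functions that, together with all their derivatives, are
bounded by `weight ^ (a + ε)` for every `ε > 0`. -/
inductive Symb : ℤ → (ℝ → ℝ) → Prop
  | const (c : ℝ) : Symb 0 (fun _ => c)
  | id : Symb 0 (fun y => y)
  | inv_sub : Symb 0 (fun y => (1 - y)⁻¹)
  | inv_add : Symb 0 (fun y => (1 + y)⁻¹)
  | exp_sub : Symb 1 (fun y => Real.exp (1 - y)⁻¹)
  | exp_add : Symb 1 (fun y => Real.exp (1 + y)⁻¹)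
  | velocity : Symb (-1) vel
  | add {a : ℤ} {f g : ℝ → ℝ} : Symb a f → Symb a g → Symb a (fun y => f y + g y)
  | mul {a b : ℤ} {f g : ℝ → ℝ} : Symb a f → Symb b g → Symb (a + b) (fun y => f y * g y)
  | congr {a : ℤ} {f g : ℝ → ℝ} : Symb a f → EqOn f g (Ioo (-1) 1) → Symb a g

lemma Symb.cast {a b : ℤ} {f : ℝ → ℝ} (h : Symb a f) (hab : a = b) : Symb b f := hab ▸ h

lemma Symb.const_mul {a : ℤ} {f : ℝ → ℝ} (c : ℝ) (h : Symb a f) : Symb a (fun y => c * f y) :=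
  ((Symb.const c).mul h).cast (zero_add a)

lemma weight_pos (y : ℝ) : 0 < weight y := by unfold weight; positivity

lemma one_le_weight (y : ℝ) : 1 ≤ weight y := by
  unfold weight; linarith [abs_nonneg (time y)]

lemma slope_pos {y : ℝ} (hy : y ∈ Ioo (-1 : ℝ) 1) : 0 < slope y := by
  have h1 : 0 < 1 - y := by linarith [hy.2]
  have h2 : 0 < 1 + y := by linarith [hy.1]
  unfold slope; positivity

lemma hasDerivAt_inv_sub {y : ℝ} (hy : y ∈ Ioo (-1 : ℝ) 1) :
    HasDerivAt (fun y : ℝ => (1 - y)⁻¹) ((1 - y)⁻¹ * (1 - y)⁻¹) y := by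
  have h1 : 1 - y ≠ 0 := by linarith [hy.2]
  refine (((hasDerivAt_id' y).const_sub 1).inv h1).congr_deriv ?_
  field_simp

lemma hasDerivAt_inv_add {y : ℝ} (hy : y ∈ Ioo (-1 : ℝ) 1) :
    HasDerivAt (fun y : ℝ => (1 + y)⁻¹) (-1 * ((1 + y)⁻¹ * (1 + y)⁻¹)) y := by
  have h1 : 1 + y ≠ 0 := by linarith [hy.1]
  refine (((hasDerivAt_id' y).const_add 1).inv h1).congr_deriv ?_
  field_simp

lemma hasDerivAt_time {y : ℝ} (hy : y ∈ Ioo (-1 : ℝ) 1) : HasDerivAt time (slope y) y := by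
  refine ((hasDerivAt_inv_sub hy).exp.sub (hasDerivAt_inv_add hy).exp).congr_deriv ?_
  unfold slope; ring

/-- The derivative of `slope` on `(-1, 1)`. -/
noncomputable def slopeDeriv (y : ℝ) : ℝ :=
  (2 * (1 - y)⁻¹ + (1 - y)⁻¹ * (1 - y)⁻¹) * ((1 - y)⁻¹ * (1 - y)⁻¹) * Real.exp (1 - y)⁻¹ +
    -1 * ((2 * (1 + y)⁻¹ + (1 + y)⁻¹ * (1 + y)⁻¹) * ((1 + y)⁻¹ * (1 + y)⁻¹) *
      Real.exp (1 + y)⁻¹)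

lemma hasDerivAt_slope {y : ℝ} (hy : y ∈ Ioo (-1 : ℝ) 1) :
    HasDerivAt slope (slopeDeriv y) y := by
  have h1 := hasDerivAt_inv_sub hy
  have h2 := hasDerivAt_inv_add hy
  refine (((h1.mul h1).mul h1.exp).add ((h2.mul h2).mul h2.exp)).congr_deriv ?_
  simp only [slopeDeriv, Pi.mul_apply]; ring

lemma symb_slope : Symb 1 slope :=
  (((Symb.inv_sub.mul .inv_sub).mul .exp_sub).cast (by norm_num)).add
    (((Symb.inv_add.mul .inv_add).mul .exp_add).cast (by norm_num))

lemma symb_slopeDeriv : Symb 1 slopeDeriv := by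
  refine Symb.add ?_ (Symb.const_mul _ ?_)
  · exact (((Symb.inv_sub.const_mul 2).add ((Symb.inv_sub.mul .inv_sub).cast (by norm_num))).mul
      (Symb.inv_sub.mul .inv_sub)).mul .exp_sub |>.cast (by norm_num)
  · exact (((Symb.inv_add.const_mul 2).add ((Symb.inv_add.mul .inv_add).cast (by norm_num))).mul
      (Symb.inv_add.mul .inv_add)).mul .exp_add |>.cast (by norm_num)

lemma Symb.deriv_of_hasDerivAt {a : ℤ} {f f' : ℝ → ℝ}
    (h : ∀ y ∈ Ioo (-1 : ℝ) 1, HasDerivAt f (f' y) y) (hf' : Symb a f') :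
    (∀ y ∈ Ioo (-1 : ℝ) 1, DifferentiableAt ℝ f y) ∧ Symb a (deriv f) :=
  ⟨fun y hy => (h y hy).differentiableAt, hf'.congr fun y hy => (h y hy).deriv.symm⟩

lemma Symb.differentiableAt_and_deriv {a : ℤ} {f : ℝ → ℝ} (h : Symb a f) :
    (∀ y ∈ Ioo (-1 : ℝ) 1, DifferentiableAt ℝ f y) ∧ Symb a (deriv f) := by
  induction h with
  | const c => exact deriv_of_hasDerivAt (fun y _ => hasDerivAt_const y c) (.const 0)
  | id => exact deriv_of_hasDerivAt (fun y _ => hasDerivAt_id y) (.const 1)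
  | inv_sub =>
    exact deriv_of_hasDerivAt (fun y hy => hasDerivAt_inv_sub hy)
      ((Symb.inv_sub.mul .inv_sub).cast (by norm_num))
  | inv_add =>
    exact deriv_of_hasDerivAt (fun y hy => hasDerivAt_inv_add hy)
      (((Symb.inv_add.mul .inv_add).cast (by norm_num)).const_mul _)
  | exp_sub =>
    exact deriv_of_hasDerivAt (fun y hy => (hasDerivAt_inv_sub hy).exp)
      ((Symb.exp_sub.mul (Symb.inv_sub.mul .inv_sub)).cast (by norm_num))
  | exp_add =>
    exact deriv_of_hasDerivAt (fun y hy => (hasDerivAt_inv_add hy).exp)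
      ((Symb.exp_add.mul ((Symb.inv_add.mul .inv_add).const_mul _)).cast (by norm_num))
  | velocity =>
    refine deriv_of_hasDerivAt (f' := fun y => -1 * (slopeDeriv y * (vel y * vel y)))
      (fun y hy => ?_) (((symb_slopeDeriv.mul (Symb.velocity.mul .velocity)).cast (by norm_num)).const_mul _)
    refine ((hasDerivAt_slope hy).inv (slope_pos hy).ne').congr_deriv ?_
    have := (slope_pos hy).ne'
    simp only [vel]; field_simp
  | add _ _ ihf ihg =>
    exact deriv_of_hasDerivAt
      (fun y hy => (ihf.1 y hy).hasDerivAt.add (ihg.1 y hy).hasDerivAt) (ihf.2.add ihg.2)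
  | mul hf hg ihf ihg =>
    exact deriv_of_hasDerivAt
      (fun y hy => (ihf.1 y hy).hasDerivAt.mul (ihg.1 y hy).hasDerivAt)
      ((ihf.2.mul hg).add (hf.mul ihg.2))
  | congr _ hfg ihf =>
    refine deriv_of_hasDerivAt (fun y hy => ?_) ihf.2
    exact (ihf.1 y hy).hasDerivAt.congr_of_eventuallyEq
      ((hfg.eventuallyEq_of_mem (isOpen_Ioo.mem_nhds hy)).symm)

lemma exp_le_weight {y : ℝ} (hy : y ∈ Ioo (-1 : ℝ) 1) :
    Real.exp (1 - y)⁻¹ ≤ 3 * weight y ∧ Real.exp (1 + y)⁻¹ ≤ 3 * weight y := by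
  have h1 : 0 < 1 - y := by linarith [hy.2]
  have h2 : 0 < 1 + y := by linarith [hy.1]
  have he := Real.exp_one_lt_three
  have ha := abs_le.1 (le_refl |time y|)
  have ht : time y = Real.exp (1 - y)⁻¹ - Real.exp (1 + y)⁻¹ := rfl
  unfold weight
  rcases le_total 0 y with h | h
  · have : Real.exp (1 + y)⁻¹ ≤ Real.exp 1 :=
      Real.exp_le_exp.2 (inv_le_one_of_one_le₀ (by linarith))
    constructor <;> linarith
  · have : Real.exp (1 - y)⁻¹ ≤ Real.exp 1 :=
      Real.exp_le_exp.2 (inv_le_one_of_one_le₀ (by linarith))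
    constructor <;> linarith

lemma vel_le {y : ℝ} (hy : y ∈ Ioo (-1 : ℝ) 1) : |vel y| ≤ 8 * (weight y)⁻¹ := by
  have h1 : 0 < 1 - y := by linarith [hy.2]
  have h2 : 0 < 1 + y := by linarith [hy.1]
  have hs := slope_pos hy
  have h : weight y ≤ 8 * slope y := by
    have e1 : (1 : ℝ) / 2 ≤ (1 - y)⁻¹ := by
      rw [one_div]; exact inv_anti₀ h1 (by linarith [hy.1])
    have e2 : (1 : ℝ) / 2 ≤ (1 + y)⁻¹ := by
      rw [one_div]; exact inv_anti₀ h2 (by linarith [hy.2])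
    have x1 : 1 ≤ Real.exp (1 - y)⁻¹ := Real.one_le_exp (by positivity)
    have x2 : 1 ≤ Real.exp (1 + y)⁻¹ := Real.one_le_exp (by positivity)
    have ht : |time y| ≤ Real.exp (1 - y)⁻¹ + Real.exp (1 + y)⁻¹ := by
      unfold time; rw [abs_le]; constructor <;> linarith
    have p1 : (1 : ℝ) / 4 ≤ (1 - y)⁻¹ * (1 - y)⁻¹ := by nlinarith
    have p2 : (1 : ℝ) / 4 ≤ (1 + y)⁻¹ * (1 + y)⁻¹ := by nlinarith
    have q1 := mul_le_mul_of_nonneg_right p1 (zero_le_one.trans x1)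
    have q2 := mul_le_mul_of_nonneg_right p2 (zero_le_one.trans x2)
    unfold weight slope
    linarith
  rw [vel, abs_of_pos (inv_pos.2 hs), inv_le_iff_one_le_mul₀ hs]
  have hw := weight_pos y
  rw [mul_right_comm, ← div_eq_mul_inv, le_div_iff₀ hw]
  linarith

lemma le_exp_mul {ε : ℝ} (hε : 0 < ε) (t : ℝ) : t ≤ ε⁻¹ * Real.exp t ^ ε := by
  rw [← Real.exp_mul]
  have := Real.add_one_le_exp (t * ε)
  rw [← div_eq_inv_mul, le_div_iff₀ hε]
  linarith

lemma Symb.bound {a : ℤ} {f : ℝ → ℝ} (h : Symb a f) :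
    ∀ ε > 0, ∃ C : ℝ, 0 ≤ C ∧ ∀ y ∈ Ioo (-1 : ℝ) 1, |f y| ≤ C * weight y ^ ((a : ℝ) + ε) := by
  have hpow : ∀ ε > 0, ∀ y, 1 ≤ weight y ^ (((0 : ℤ) : ℝ) + ε) := fun ε hε y =>
    Real.one_le_rpow (one_le_weight y) (by simpa using hε.le)
  have hexp : ∀ ε > 0, ∀ y, weight y ≤ weight y ^ (((1 : ℤ) : ℝ) + ε) := fun ε hε y => by
    conv_lhs => rw [← Real.rpow_one (weight y)]
    exact Real.rpow_le_rpow_of_exponent_le (one_le_weight y) (by push_cast; linarith)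
  have hinv : ∀ ε > 0, ∀ t y, 0 ≤ t → Real.exp t ≤ 3 * weight y →
      |t| ≤ (ε⁻¹ * 3 ^ ε) * weight y ^ (((0 : ℤ) : ℝ) + ε) := by
    intro ε hε t y ht0 ht
    rw [abs_of_nonneg ht0]
    refine (le_exp_mul hε t).trans ?_
    rw [Int.cast_zero, zero_add, mul_assoc, ← Real.mul_rpow (by norm_num) (weight_pos y).le]
    gcongr
  induction h with
  | const c =>
    intro ε hε
    exact ⟨|c|, abs_nonneg c, fun y _ => le_mul_of_one_le_right (abs_nonneg c) (hpow ε hε y)⟩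
  | id =>
    intro ε hε
    refine ⟨1, zero_le_one, fun y hy => ?_⟩
    have := hpow ε hε y
    have := abs_lt.2 hy
    linarith
  | inv_sub =>
    intro ε hε
    exact ⟨_, by positivity, fun y hy =>
      hinv ε hε _ y (inv_nonneg.2 (by linarith [hy.2])) (exp_le_weight hy).1⟩
  | inv_add =>
    intro ε hε
    exact ⟨_, by positivity, fun y hy =>
      hinv ε hε _ y (inv_nonneg.2 (by linarith [hy.1])) (exp_le_weight hy).2⟩
  | exp_sub =>
    intro ε hε
    refine ⟨3, by norm_num, fun y hy => ?_⟩
    rw [abs_of_pos (Real.exp_pos _)]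
    exact (exp_le_weight hy).1.trans (mul_le_mul_of_nonneg_left (hexp ε hε y) (by norm_num))
  | exp_add =>
    intro ε hε
    refine ⟨3, by norm_num, fun y hy => ?_⟩
    rw [abs_of_pos (Real.exp_pos _)]
    exact (exp_le_weight hy).2.trans (mul_le_mul_of_nonneg_left (hexp ε hε y) (by norm_num))
  | velocity =>
    intro ε hε
    refine ⟨8, by norm_num, fun y hy => (vel_le hy).trans ?_⟩
    rw [← Real.rpow_neg_one]
    gcongr
    · exact one_le_weight y
    · push_cast; linarith
  | add _ _ ihf ihg =>
    intro ε hε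
    obtain ⟨C, hC, hf⟩ := ihf ε hε
    obtain ⟨D, hD, hg⟩ := ihg ε hε
    refine ⟨C + D, by positivity, fun y hy => (abs_add_le _ _).trans ?_⟩
    rw [add_mul]
    exact add_le_add (hf y hy) (hg y hy)
  | mul _ _ ihf ihg =>
    intro ε hε
    obtain ⟨C, hC, hf⟩ := ihf (ε / 2) (by positivity)
    obtain ⟨D, hD, hg⟩ := ihg (ε / 2) (by positivity)
    refine ⟨C * D, by positivity, fun y hy => ?_⟩
    rw [abs_mul]
    refine (mul_le_mul (hf y hy) (hg y hy) (abs_nonneg _)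
      (mul_nonneg hC (Real.rpow_nonneg (weight_pos y).le _))).trans_eq ?_
    rw [mul_mul_mul_comm, ← Real.rpow_add (weight_pos y)]
    push_cast
    ring_nf
  | congr _ hfg ihf =>
    intro ε hε
    obtain ⟨C, hC, hf⟩ := ihf ε hε
    exact ⟨C, hC, fun y hy => hfg hy ▸ hf y hy⟩

lemma strictMonoOn_time : StrictMonoOn time (Ioo (-1) 1) := by
  refine strictMonoOn_of_deriv_pos (convex_Ioo _ _)
    (fun y hy => (hasDerivAt_time hy).continuousAt.continuousWithinAt) fun y hy => ?_
  rw [interior_Ioo] at hy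
  rw [(hasDerivAt_time hy).deriv]
  exact slope_pos hy

lemma time_neg (y : ℝ) : time (-y) = -time y := by
  simp [time, ← sub_eq_add_neg]

lemma exists_le_time (t : ℝ) : ∃ y ∈ Ico (0 : ℝ) 1, |t| ≤ time y := by
  have hP : 0 < |t| + 3 := by positivity
  have hP1 : (|t| + 3)⁻¹ ≤ 1 := inv_le_one_of_one_le₀ (by linarith [abs_nonneg t])
  have hP0 : 0 < (|t| + 3)⁻¹ := inv_pos.2 hP
  refine ⟨1 - (|t| + 3)⁻¹, ⟨by linarith, by linarith⟩, ?_⟩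
  have h1 : Real.exp (1 + (1 - (|t| + 3)⁻¹))⁻¹ ≤ Real.exp 1 :=
    Real.exp_le_exp.2 (inv_le_one_of_one_le₀ (by linarith))
  have h2 := Real.add_one_le_exp (|t| + 3)
  have h3 := Real.exp_one_lt_three
  rw [time, sub_sub_cancel, inv_inv]
  linarith

lemma exists_time_eq (t : ℝ) : ∃ y ∈ Ioo (-1 : ℝ) 1, time y = t := by
  obtain ⟨z, hz, ht⟩ := exists_le_time t
  have ht' := abs_le.1 (le_refl |t|)
  have hsub : Icc (-z) z ⊆ Ioo (-1 : ℝ) 1 := fun y hy =>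
    ⟨by linarith [hy.1, hz.2], by linarith [hy.2, hz.2]⟩
  have hc : ContinuousOn time (Icc (-z) z) := fun y hy =>
    (hasDerivAt_time (hsub hy)).continuousAt.continuousWithinAt
  obtain ⟨y, hy, hyt⟩ := intermediate_value_Icc (by linarith [hz.1]) hc
    (show t ∈ Icc (time (-z)) (time z) by
      rw [time_neg]; constructor <;> linarith)
  exact ⟨y, hsub hy, hyt⟩

/-- The inverse `ℝ → (-1, 1)` of `time`. -/
noncomputable def pos (t : ℝ) : ℝ := (exists_time_eq t).choose

lemma pos_mem (t : ℝ) : pos t ∈ Ioo (-1 : ℝ) 1 := (exists_time_eq t).choose_spec.1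

lemma time_pos (t : ℝ) : time (pos t) = t := (exists_time_eq t).choose_spec.2

lemma pos_time {y : ℝ} (hy : y ∈ Ioo (-1 : ℝ) 1) : pos (time y) = y :=
  strictMonoOn_time.injOn (pos_mem _) hy (time_pos _)

lemma range_pos : range pos = Ioo (-1) 1 :=
  Subset.antisymm (range_subset_iff.2 pos_mem) fun y hy => ⟨time y, pos_time hy⟩

lemma strictMono_pos : StrictMono pos := fun s t hst => by
  rwa [← strictMonoOn_time.lt_iff_lt (pos_mem s) (pos_mem t), time_pos, time_pos]

lemma hasDerivAt_pos (t : ℝ) : HasDerivAt pos (vel (pos t)) t := by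
  refine HasDerivAt.of_local_left_inverse ?_ (hasDerivAt_time (pos_mem t))
    (slope_pos (pos_mem t)).ne' (Filter.Eventually.of_forall time_pos)
  refine (strictMono_pos.strictMonoOn univ).continuousAt_of_image_mem_nhds Filter.univ_mem ?_
  rw [image_univ, range_pos]
  exact isOpen_Ioo.mem_nhds (pos_mem t)

/-- The iterated derivatives of `pos`, expressed as functions of the position. -/
noncomputable def posDeriv : ℕ → ℝ → ℝ
  | 0 => fun y => y
  | m + 1 => fun y => vel y * deriv (posDeriv m) y

lemma symb_posDeriv (m : ℕ) : Symb (-m) (posDeriv m) := by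
  induction m with
  | zero => exact Symb.id.cast (by simp)
  | succ m ih => exact (Symb.velocity.mul ih.differentiableAt_and_deriv.2).cast (by push_cast; ring)

lemma hasDerivAt_posDeriv (m : ℕ) (t : ℝ) :
    HasDerivAt (fun t => posDeriv m (pos t)) (posDeriv (m + 1) (pos t)) t := by
  refine HasDerivAt.congr_deriv (HasDerivAt.comp t
    ((symb_posDeriv m).differentiableAt_and_deriv.1 _ (pos_mem t)).hasDerivAt
    (hasDerivAt_pos t)) ?_
  rw [posDeriv, mul_comm]

lemma posDeriv_bounded (m : ℕ) :
    ∃ C : ℝ, 0 ≤ C ∧ ∀ y ∈ Ioo (-1 : ℝ) 1, |posDeriv m y| ≤ C := by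
  rcases m with _ | m
  · exact ⟨1, zero_le_one, fun y hy => (abs_lt.2 hy).le⟩
  · obtain ⟨C, hC, h⟩ := (symb_posDeriv (m + 1)).bound 1 one_pos
    refine ⟨C, hC, fun y hy => (h y hy).trans (mul_le_of_le_one_right hC ?_)⟩
    refine Real.rpow_le_one_of_one_le_of_nonpos (one_le_weight y) ?_
    push_cast
    linarith [(Nat.cast_nonneg m : (0 : ℝ) ≤ m)]

/-- The coefficient of `f⁽ʲ⁾ (time y + x)` in the `l`-th derivative of `f (time y + x)`
with respect to `y`. -/
noncomputable def coeff : ℕ → ℕ → ℝ → ℝ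
  | 0, 0 => fun _ => 1
  | 0, _ + 1 => fun _ => 0
  | l + 1, 0 => deriv (coeff l 0)
  | l + 1, j + 1 => fun y => deriv (coeff l (j + 1)) y + slope y * coeff l j y

lemma Symb.zero (j : ℕ) : Symb j (fun _ => 0) := by
  induction j with
  | zero => exact .const 0
  | succ j ih =>
    exact ((symb_slope.mul ih).cast (by push_cast; ring)).congr fun y _ => mul_zero _

lemma symb_coeff (l j : ℕ) : Symb j (coeff l j) := by
  induction l generalizing j with
  | zero =>
    rcases j with _ | j
    · exact .const 1
    · exact .zero (j + 1)
  | succ l ih =>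
    rcases j with _ | j
    · exact (ih 0).differentiableAt_and_deriv.2
    · exact (ih (j + 1)).differentiableAt_and_deriv.2.add
        ((symb_slope.mul (ih j)).cast (by push_cast; ring))

lemma coeff_eq_zero {l j : ℕ} (h : l < j) : coeff l j = fun _ => 0 := by
  induction l generalizing j with
  | zero =>
    obtain ⟨j, rfl⟩ := Nat.exists_eq_succ_of_ne_zero h.ne'
    rfl
  | succ l ih =>
    obtain ⟨j, rfl⟩ := Nat.exists_eq_succ_of_ne_zero (Nat.ne_zero_of_lt h)
    funext y
    rw [coeff, ih (by omega), ih (by omega)]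
    simp

/-- The mixed derivatives of `(x, y) ↦ pos (time y + x)`. -/
noncomputable def core (k l : ℕ) (x y : ℝ) : ℝ :=
  ∑ j ∈ Finset.range (l + 1), coeff l j y * posDeriv (k + j) (pos (time y + x))

/-- The mixed derivatives of `(x, y) ↦ y`. -/
def sndDeriv : ℕ → ℕ → ℝ → ℝ
  | 0, 0 => fun y => y
  | 0, 1 => fun _ => 1
  | 0, _ + 2 => fun _ => 0
  | _ + 1, _ => fun _ => 0

lemma hasDerivAt_sndDeriv (k l : ℕ) (y : ℝ) :
    HasDerivAt (sndDeriv k l) (sndDeriv k (l + 1) y) y := by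
  rcases k with _ | k
  · rcases l with _ | _ | l
    · exact hasDerivAt_id y
    · exact hasDerivAt_const y 1
    · exact hasDerivAt_const y 0
  · exact hasDerivAt_const y 0

lemma abs_sndDeriv_le (k l : ℕ) {y : ℝ} (hy : |y| ≤ 1) : |sndDeriv k l y| ≤ 1 := by
  rcases k with _ | k
  · rcases l with _ | _ | l <;> simp [sndDeriv, hy]
  · simp [sndDeriv]

lemma hasFDerivAt_core (k l : ℕ) {p : ℝ × ℝ} (hp : p.2 ∈ Ioo (-1 : ℝ) 1) :
    HasFDerivAt (fun p : ℝ × ℝ => core k l p.1 p.2)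
      (core (k + 1) l p.1 p.2 • ContinuousLinearMap.fst ℝ ℝ ℝ +
        core k (l + 1) p.1 p.2 • ContinuousLinearMap.snd ℝ ℝ ℝ) p := by
  have hτ : HasFDerivAt (fun p : ℝ × ℝ => time p.2 + p.1)
      (slope p.2 • ContinuousLinearMap.snd ℝ ℝ ℝ + ContinuousLinearMap.fst ℝ ℝ ℝ) p :=
    ((hasDerivAt_time hp).comp_hasFDerivAt p hasFDerivAt_snd).add hasFDerivAt_fst
  have hterm : ∀ j, HasFDerivAt
      (fun p : ℝ × ℝ => coeff l j p.2 * posDeriv (k + j) (pos (time p.2 + p.1))) _ p := fun j =>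
    (((symb_coeff l j).differentiableAt_and_deriv.1 _ hp).hasDerivAt.comp_hasFDerivAt p
      hasFDerivAt_snd).mul ((hasDerivAt_posDeriv (k + j) _).comp_hasFDerivAt p hτ)
  refine (HasFDerivAt.fun_sum fun j (_ : j ∈ Finset.range (l + 1)) => hterm j).congr_fderiv ?_
  have hsnd : core k (l + 1) p.1 p.2 = ∑ j ∈ Finset.range (l + 1),
      (deriv (coeff l j) p.2 * posDeriv (k + j) (pos (time p.2 + p.1)) +
        slope p.2 * coeff l j p.2 * posDeriv (k + j + 1) (pos (time p.2 + p.1))) := by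
    have h0 : deriv (coeff l (l + 1)) p.2 = 0 := by
      rw [coeff_eq_zero (Nat.lt_succ_self l)]; simp
    rw [core, Finset.sum_range_succ', Finset.sum_add_distrib,
      Finset.sum_range_succ' (fun j => deriv (coeff l j) p.2 * _)]
    have : ∀ j, coeff (l + 1) (j + 1) p.2 =
      deriv (coeff l (j + 1)) p.2 + slope p.2 * coeff l j p.2 := fun _ => rfl
    simp only [this, add_mul, Finset.sum_add_distrib]
    rw [Finset.sum_range_succ (fun j => deriv (coeff l (j + 1)) p.2 * _), h0]
    simp only [coeff, add_assoc]
    ring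
  have hfst : core (k + 1) l p.1 p.2 = ∑ j ∈ Finset.range (l + 1),
      coeff l j p.2 * posDeriv (k + j + 1) (pos (time p.2 + p.1)) := by
    simp only [core, add_right_comm]
  rw [hsnd, hfst, Finset.sum_smul, Finset.sum_smul, ← Finset.sum_add_distrib]
  refine Finset.sum_congr rfl fun j _ => ?_
  ext <;> simp
  ring

/-- The mixed derivatives of the displacement `(x, y) ↦ pos (time y + x) - y`, extended by zero. -/
noncomputable def jet (k l : ℕ) (x y : ℝ) : ℝ :=
  open Classical in if y ∈ Ioo (-1 : ℝ) 1 then core k l x y - sndDeriv k l y else 0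

lemma jet_of_mem (k l : ℕ) (x : ℝ) {y : ℝ} (hy : y ∈ Ioo (-1 : ℝ) 1) :
    jet k l x y = core k l x y - sndDeriv k l y := if_pos hy

lemma jet_of_notMem (k l : ℕ) (x : ℝ) {y : ℝ} (hy : y ∉ Ioo (-1 : ℝ) 1) :
    jet k l x y = 0 := if_neg hy

lemma hasFDerivAt_jet_of_mem (k l : ℕ) {p : ℝ × ℝ} (hp : p.2 ∈ Ioo (-1 : ℝ) 1) :
    HasFDerivAt (fun p : ℝ × ℝ => jet k l p.1 p.2)
      (jet (k + 1) l p.1 p.2 • ContinuousLinearMap.fst ℝ ℝ ℝ +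
        jet k (l + 1) p.1 p.2 • ContinuousLinearMap.snd ℝ ℝ ℝ) p := by
  have h := (hasFDerivAt_core k l hp).sub
    ((hasDerivAt_sndDeriv k l p.2).comp_hasFDerivAt p hasFDerivAt_snd)
  refine (h.congr_of_eventuallyEq ?_).congr_fderiv ?_
  · filter_upwards [(isOpen_Ioo.preimage continuous_snd).mem_nhds hp] with q hq
    exact jet_of_mem k l q.1 hq
  · rw [jet_of_mem _ _ _ hp, jet_of_mem _ _ _ hp]
    ext <;> simp [sndDeriv]

lemma hasDerivAt_fst_of_hasFDerivAt {F : ℝ → ℝ → ℝ} {a b x y : ℝ}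
    (h : HasFDerivAt (fun p : ℝ × ℝ => F p.1 p.2)
      (a • ContinuousLinearMap.fst ℝ ℝ ℝ + b • ContinuousLinearMap.snd ℝ ℝ ℝ) (x, y)) :
    HasDerivAt (fun x => F x y) a x := by
  refine (HasFDerivAt.comp_hasDerivAt x h
    ((hasDerivAt_id x).prodMk (hasDerivAt_const x y))).congr_deriv ?_
  simp

lemma hasDerivAt_snd_of_hasFDerivAt {F : ℝ → ℝ → ℝ} {a b x y : ℝ}
    (h : HasFDerivAt (fun p : ℝ × ℝ => F p.1 p.2)
      (a • ContinuousLinearMap.fst ℝ ℝ ℝ + b • ContinuousLinearMap.snd ℝ ℝ ℝ) (x, y)) :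
    HasDerivAt (F x) b y := by
  refine (HasFDerivAt.comp_hasDerivAt y h
    ((hasDerivAt_const y x).prodMk (hasDerivAt_id y))).congr_deriv ?_
  simp

lemma jet_zero_left (l : ℕ) (y : ℝ) : jet 0 l 0 y = 0 := by
  by_cases hy : y ∈ Ioo (-1 : ℝ) 1
  swap
  · exact jet_of_notMem _ _ _ hy
  induction l generalizing y with
  | zero => simp [jet_of_mem _ _ _ hy, core, coeff, posDeriv, sndDeriv, pos_time hy]
  | succ l ih =>
    have h := hasDerivAt_snd_of_hasFDerivAt (hasFDerivAt_jet_of_mem 0 l (p := (0, y)) hy)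
    refine h.unique ((hasDerivAt_const y 0).congr_of_eventuallyEq ?_)
    filter_upwards [isOpen_Ioo.mem_nhds hy] with z hz using ih z hz

lemma weight_le_of_far {x y : ℝ} (h : |time y| ≤ 2 * |x|) : weight y ≤ 2 * (1 + |x|) := by
  unfold weight; linarith

lemma weight_le_of_near {x y : ℝ} (h : 2 * |x| ≤ |time y|) :
    weight y ≤ 2 * weight (pos (time y + x)) := by
  have := abs_sub_abs_le_abs_sub (time y) (-x)
  rw [abs_neg, sub_neg_eq_add] at this
  rw [weight, weight, time_pos]
  linarith

lemma Symb.abs_mul_comp_le {j k : ℕ} {b g : ℝ → ℝ} (hb : Symb j b)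
    (hg : Symb (-(k + 1 + j : ℕ)) g) :
    ∃ C : ℝ, 0 ≤ C ∧ ∀ x, ∀ y ∈ Ioo (-1 : ℝ) 1, 2 * |x| ≤ |time y| →
      |b y * g (pos (time y + x))| ≤ C * weight y ^ (-(1 / 2) : ℝ) := by
  obtain ⟨C, hC, hb⟩ := hb.bound (1 / 4) (by norm_num)
  obtain ⟨D, hD, hg⟩ := hg.bound (1 / 4) (by norm_num)
  set s : ℝ := ((-(k + 1 + j : ℕ) : ℤ) : ℝ) + 1 / 4 with hs
  have hs' : s = -(k + 1 + j) + 1 / 4 := by rw [hs]; push_cast; ring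
  have hk : (0 : ℝ) ≤ k := Nat.cast_nonneg k
  have hj : (0 : ℝ) ≤ j := Nat.cast_nonneg j
  refine ⟨C * (D * (1 / 2) ^ s), by positivity, fun x y hy hxy => ?_⟩
  have hw := weight_pos y
  have h1 : |g (pos (time y + x))| ≤ D * (1 / 2) ^ s * weight y ^ s := by
    refine (hg _ (pos_mem _)).trans ?_
    rw [mul_assoc, ← Real.mul_rpow (by norm_num) hw.le]
    refine mul_le_mul_of_nonneg_left ?_ hD
    refine Real.rpow_le_rpow_of_nonpos (by positivity) ?_ (by rw [hs']; linarith)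
    linarith [weight_le_of_near hxy]
  rw [abs_mul]
  refine (mul_le_mul (hb y hy) h1 (abs_nonneg _) (by positivity)).trans ?_
  rw [mul_mul_mul_comm, ← Real.rpow_add hw]
  refine mul_le_mul_of_nonneg_left ?_ (by positivity)
  refine Real.rpow_le_rpow_of_exponent_le (one_le_weight y) ?_
  rw [hs']
  push_cast
  linarith

lemma Symb.abs_mul_le {j : ℕ} {b : ℝ → ℝ} (hb : Symb j b) {D : ℝ} (hD : 0 ≤ D) :
    ∃ C : ℝ, 0 ≤ C ∧ ∀ x, ∀ y ∈ Ioo (-1 : ℝ) 1, |time y| ≤ 2 * |x| → ∀ z, |z| ≤ D →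
      |b y * z| ≤ C * (1 + |x|) ^ (j + 1) * weight y ^ (-(1 / 2) : ℝ) := by
  obtain ⟨C, hC, hb⟩ := hb.bound (1 / 2) (by norm_num)
  refine ⟨C * 2 ^ (j + 1) * D, by positivity, fun x y hy hxy z hz => ?_⟩
  have hw := weight_pos y
  have h1 : weight y ^ (((j : ℤ) : ℝ) + 1 / 2) ≤
      2 ^ (j + 1) * (1 + |x|) ^ (j + 1) * weight y ^ (-(1 / 2) : ℝ) := by
    rw [← mul_pow, show ((j : ℤ) : ℝ) + 1 / 2 = ((j + 1 : ℕ) : ℝ) + -(1 / 2) by push_cast; ring,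
      Real.rpow_add hw, Real.rpow_natCast]
    gcongr
    exact weight_le_of_far hxy
  rw [abs_mul]
  calc |b y| * |z| ≤ (C * (2 ^ (j + 1) * (1 + |x|) ^ (j + 1) * weight y ^ (-(1 / 2) : ℝ))) * D :=
        mul_le_mul ((hb y hy).trans (mul_le_mul_of_nonneg_left h1 hC)) hz (abs_nonneg _)
          (by positivity)
    _ = _ := by ring

lemma core_le_near (k l : ℕ) :
    ∃ C : ℝ, 0 ≤ C ∧ ∀ x, ∀ y ∈ Ioo (-1 : ℝ) 1, 2 * |x| ≤ |time y| →
      |core (k + 1) l x y| ≤ C * weight y ^ (-(1 / 2) : ℝ) := by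
  choose C hC h using fun j => (symb_coeff l j).abs_mul_comp_le (symb_posDeriv (k + 1 + j))
  refine ⟨∑ j ∈ Finset.range (l + 1), C j, Finset.sum_nonneg fun j _ => hC j,
    fun x y hy hxy => (Finset.abs_sum_le_sum_abs _ _).trans ?_⟩
  rw [Finset.sum_mul]
  exact Finset.sum_le_sum fun j _ => h j x y hy hxy

lemma core_le_far (k l : ℕ) :
    ∃ C : ℝ, 0 ≤ C ∧ ∀ x, ∀ y ∈ Ioo (-1 : ℝ) 1, |time y| ≤ 2 * |x| →
      |core k l x y| ≤ C * (1 + |x|) ^ (2 * l + 1) * weight y ^ (-(1 / 2) : ℝ) := by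
  choose D hD hg using fun j => posDeriv_bounded (k + j)
  choose C hC h using fun j => (symb_coeff l j).abs_mul_le (hD j)
  refine ⟨∑ j ∈ Finset.range (l + 1), C j, Finset.sum_nonneg fun j _ => hC j,
    fun x y hy hxy => (Finset.abs_sum_le_sum_abs _ _).trans ?_⟩
  rw [mul_assoc, Finset.sum_mul]
  refine Finset.sum_le_sum fun j hj => (h j x y hy hxy _ (hg j _ (pos_mem _))).trans ?_
  have hj' := Finset.mem_range.1 hj
  have hw := weight_pos y
  have hCj := hC j
  rw [← mul_assoc]
  gcongr
  · linarith [abs_nonneg x]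
  · omega

lemma jet_le_near (k l : ℕ) :
    ∃ C : ℝ, 0 ≤ C ∧ ∀ x, ∀ y ∈ Ioo (-1 : ℝ) 1, 2 * |x| ≤ |time y| →
      |jet k l x y| ≤ C * (1 + |x|) * weight y ^ (-(1 / 2) : ℝ) := by
  have hsucc : ∀ k, ∃ C : ℝ, 0 ≤ C ∧ ∀ x, ∀ y ∈ Ioo (-1 : ℝ) 1, 2 * |x| ≤ |time y| →
      |jet (k + 1) l x y| ≤ C * weight y ^ (-(1 / 2) : ℝ) := by
    intro k
    obtain ⟨C, hC, h⟩ := core_le_near k l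
    refine ⟨C, hC, fun x y hy hxy => ?_⟩
    rw [jet_of_mem _ _ _ hy, sndDeriv, sub_zero]
    exact h x y hy hxy
  rcases k with _ | k
  · obtain ⟨C, hC, h⟩ := hsucc 0
    refine ⟨C, hC, fun x y hy hxy => ?_⟩
    have hw := weight_pos y
    have hmv := (convex_Icc (-|x|) |x|).norm_image_sub_le_of_norm_hasDerivWithin_le
      (f := fun x => jet 0 l x y) (f' := fun x => jet 1 l x y)
      (C := C * weight y ^ (-(1 / 2) : ℝ)) (x := 0) (y := x)
      (fun z _ => (hasDerivAt_fst_of_hasFDerivAt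
        (hasFDerivAt_jet_of_mem 0 l (p := (z, y)) hy)).hasDerivWithinAt)
      (fun z hz => h z y hy (by linarith [abs_le.2 hz])) (by simp) (abs_le.1 le_rfl)
    rw [jet_zero_left, sub_zero, sub_zero, Real.norm_eq_abs, Real.norm_eq_abs,
      mul_right_comm] at hmv
    refine hmv.trans ?_
    gcongr
    linarith
  · obtain ⟨C, hC, h⟩ := hsucc k
    refine ⟨C, hC, fun x y hy hxy => (h x y hy hxy).trans ?_⟩
    have hw := weight_pos y
    gcongr
    exact le_mul_of_one_le_right hC (by linarith [abs_nonneg x])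

lemma jet_le_far (k l : ℕ) :
    ∃ C : ℝ, 0 ≤ C ∧ ∀ x, ∀ y ∈ Ioo (-1 : ℝ) 1, |time y| ≤ 2 * |x| →
      |jet k l x y| ≤ C * (1 + |x|) ^ (2 * l + 1) * weight y ^ (-(1 / 2) : ℝ) := by
  obtain ⟨C, hC, h⟩ := core_le_far k l
  obtain ⟨D, hD, h'⟩ := Symb.abs_mul_le (j := 0) (.const 1) zero_le_one
  refine ⟨C + D, by positivity, fun x y hy hxy => ?_⟩
  rw [jet_of_mem _ _ _ hy]
  refine (abs_sub _ _).trans ?_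
  have hs := h' x y hy hxy _ (abs_sndDeriv_le k l (abs_lt.2 hy).le)
  rw [one_mul] at hs
  rw [add_mul, add_mul]
  refine add_le_add (h x y hy hxy) (hs.trans ?_)
  have hw := weight_pos y
  gcongr
  · linarith [abs_nonneg x]
  · omega

lemma jet_le (k l : ℕ) :
    ∃ C : ℝ, 0 ≤ C ∧ ∀ x, ∀ y ∈ Ioo (-1 : ℝ) 1,
      |jet k l x y| ≤ C * (1 + |x|) ^ (2 * l + 1) * weight y ^ (-(1 / 2) : ℝ) := by
  obtain ⟨C, hC, h⟩ := jet_le_near k l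
  obtain ⟨D, hD, h'⟩ := jet_le_far k l
  refine ⟨C + D, by positivity, fun x y hy => ?_⟩
  have hw := weight_pos y
  have hx : 1 ≤ 1 + |x| := by linarith [abs_nonneg x]
  rcases le_total (2 * |x|) |time y| with hxy | hxy
  · refine (h x y hy hxy).trans ?_
    gcongr
    · linarith
    · exact le_self_pow₀ hx (by omega)
  · refine (h' x y hy hxy).trans ?_
    gcongr
    linarith

lemma inv_pow_four_le_weight {y : ℝ} (hy : y ∈ Ioo (-1 : ℝ) 1) :
    ((1 - |y|)⁻¹) ^ 4 ≤ 72 * weight y := by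
  have hexp : ∀ t : ℝ, 0 ≤ t → t ^ 4 ≤ 24 * Real.exp t := fun t ht => by
    have := Real.pow_div_factorial_le_exp t ht 4
    rw [div_le_iff₀ (by positivity)] at this
    norm_num [Nat.factorial] at this
    linarith
  obtain ⟨h1, h2⟩ := exp_le_weight hy
  have hpos : 0 ≤ (1 - |y|)⁻¹ := inv_nonneg.2 (by linarith [abs_lt.2 hy])
  rcases abs_cases y with ⟨h, _⟩ | ⟨h, _⟩ <;> rw [h] at hpos ⊢
  · linarith [hexp _ hpos]
  · rw [sub_neg_eq_add] at hpos ⊢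
    linarith [hexp _ hpos]

lemma weight_rpow_le {y : ℝ} (hy : y ∈ Ioo (-1 : ℝ) 1) :
    weight y ^ (-(1 / 2) : ℝ) ≤ 9 * (1 - |y|) ^ 2 := by
  have hd : 0 < 1 - |y| := by linarith [abs_lt.2 hy]
  have hw := weight_pos y
  have h := inv_pow_four_le_weight hy
  rw [Real.rpow_neg hw.le, ← Real.sqrt_eq_rpow, inv_le_iff_one_le_mul₀ (Real.sqrt_pos.2 hw)]
  have h1 : ((1 - |y|)⁻¹) ^ 2 ≤ 9 * √(weight y) := by
    rw [← Real.sqrt_sq (show (0 : ℝ) ≤ 9 by norm_num), ← Real.sqrt_mul (by norm_num)]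
    refine Real.le_sqrt_of_sq_le ?_
    rw [← pow_mul]
    linarith
  rw [inv_pow, inv_le_iff_one_le_mul₀ (by positivity)] at h1
  linarith

lemma jet_le_one_sub_sq (k l : ℕ) :
    ∃ C : ℝ, 0 ≤ C ∧ ∀ x, ∀ y ∈ Ioo (-1 : ℝ) 1,
      |jet k l x y| ≤ C * (1 + |x|) ^ (2 * l + 1) * (1 - |y|) ^ 2 := by
  obtain ⟨C, hC, h⟩ := jet_le k l
  refine ⟨C * 9, by positivity, fun x y hy => (h x y hy).trans ?_⟩
  rw [mul_right_comm C 9, mul_assoc _ 9]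
  gcongr
  exact weight_rpow_le hy

lemma hasFDerivAt_jet (k l : ℕ) (p : ℝ × ℝ) :
    HasFDerivAt (fun p : ℝ × ℝ => jet k l p.1 p.2)
      (jet (k + 1) l p.1 p.2 • ContinuousLinearMap.fst ℝ ℝ ℝ +
        jet k (l + 1) p.1 p.2 • ContinuousLinearMap.snd ℝ ℝ ℝ) p := by
  by_cases hp : p.2 ∈ Ioo (-1 : ℝ) 1
  · exact hasFDerivAt_jet_of_mem k l hp
  obtain ⟨C, hC, h⟩ := jet_le_one_sub_sq k l
  rw [jet_of_notMem _ _ _ hp, jet_of_notMem _ _ _ hp, zero_smul, zero_smul, add_zero]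
  have hp1 : 1 ≤ |p.2| := by
    by_contra! hlt
    exact hp (abs_lt.1 hlt)
  have hO : (fun q : ℝ × ℝ => jet k l q.1 q.2) =O[nhds p] fun q => ‖q - p‖ ^ 2 := by
    refine Asymptotics.IsBigO.of_bound (C * (1 + (|p.1| + 1)) ^ (2 * l + 1)) ?_
    filter_upwards [Metric.ball_mem_nhds p one_pos] with q hq
    rw [mem_ball_iff_norm] at hq
    by_cases hq2 : q.2 ∈ Ioo (-1 : ℝ) 1
    · have hfst : |q.1 - p.1| ≤ ‖q - p‖ := norm_fst_le (q - p)
      have hsnd : |q.2 - p.2| ≤ ‖q - p‖ := norm_snd_le (q - p)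
      have h1 := abs_sub_abs_le_abs_sub q.1 p.1
      have h2 := abs_sub_abs_le_abs_sub p.2 q.2
      rw [abs_sub_comm] at h2
      have h3 : 0 ≤ 1 - |q.2| := by linarith [abs_lt.2 hq2]
      rw [Real.norm_eq_abs, norm_pow, norm_norm]
      refine (h _ _ hq2).trans ?_
      gcongr <;> linarith
    · rw [jet_of_notMem _ _ _ hq2, norm_zero]
      positivity
  exact hO.hasFDerivAt (by norm_num)

lemma contDiff_jet (n k l : ℕ) : ContDiff ℝ n (fun p : ℝ × ℝ => jet k l p.1 p.2) := by
  induction n generalizing k l with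
  | zero =>
    exact contDiff_zero.2 (continuous_iff_continuousAt.2 fun p =>
      (hasFDerivAt_jet k l p).continuousAt)
  | succ n ih =>
    exact contDiff_succ_iff_hasFDerivAt.2 ⟨_,
      ((ih (k + 1) l).smul contDiff_const).add ((ih k (l + 1)).smul contDiff_const),
      hasFDerivAt_jet k l⟩

lemma abs_jet_le (k l : ℕ) :
    ∃ C : ℝ, 0 ≤ C ∧ ∀ x y, |jet k l x y| ≤ C * (1 + |x|) ^ (2 * l + 1) := by
  obtain ⟨C, hC, h⟩ := jet_le_one_sub_sq k l
  refine ⟨C, hC, fun x y => ?_⟩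
  by_cases hy : y ∈ Ioo (-1 : ℝ) 1
  · refine (h x y hy).trans (mul_le_of_le_one_right (by positivity) ?_)
    have := abs_lt.2 hy
    exact pow_le_one₀ (by linarith) (by linarith [abs_nonneg y])
  · rw [jet_of_notMem _ _ _ hy, abs_zero]
    positivity

/-- The flow on the line that is conjugate to translation on `(-1, 1)` and trivial elsewhere. -/
noncomputable def flow (x y : ℝ) : ℝ := jet 0 0 x y + y

lemma flow_of_mem (x : ℝ) {y : ℝ} (hy : y ∈ Ioo (-1 : ℝ) 1) :
    flow x y = pos (time y + x) := by
  simp [flow, jet_of_mem _ _ _ hy, core, coeff, posDeriv, sndDeriv]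

lemma flow_of_notMem (x : ℝ) {y : ℝ} (hy : y ∉ Ioo (-1 : ℝ) 1) : flow x y = y := by
  rw [flow, jet_of_notMem _ _ _ hy, zero_add]

lemma contDiff_flow : ContDiff ℝ (⊤ : ℕ∞) (fun p : ℝ × ℝ => flow p.1 p.2) :=
  (contDiff_infty.2 fun n => contDiff_jet n 0 0).add contDiff_snd

lemma flow_flow (x x' y : ℝ) : flow x (flow x' y) = flow (x + x') y := by
  by_cases hy : y ∈ Ioo (-1 : ℝ) 1
  · rw [flow_of_mem x' hy, flow_of_mem _ (pos_mem _), flow_of_mem _ hy, time_pos]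
    ring_nf
  · rw [flow_of_notMem x' hy, flow_of_notMem _ hy, flow_of_notMem _ hy]

lemma range_flow {y : ℝ} (hy : y ∈ Ioo (-1 : ℝ) 1) :
    range (fun x => flow x y) = Ioo (-1) 1 := by
  have : (fun x => flow x y) = pos ∘ fun x => time y + x := funext fun x => flow_of_mem x hy
  rw [this, (add_left_surjective (time y)).range_comp, range_pos]

lemma iterate_deriv_snd_flow (l : ℕ) (x : ℝ) :
    deriv^[l] (fun y => flow x y) = fun y => jet 0 l x y + sndDeriv 0 l y := by
  induction l with
  | zero => rfl
  | succ l ih =>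
    rw [Function.iterate_succ_apply', ih]
    funext y
    exact ((hasDerivAt_snd_of_hasFDerivAt (hasFDerivAt_jet 0 l (x, y))).add
      (hasDerivAt_sndDeriv 0 l y)).deriv

lemma iterate_deriv_fst_jet (k l : ℕ) (y : ℝ) :
    deriv^[k] (fun x => jet 0 l x y + sndDeriv 0 l y) =
      fun x => jet k l x y + sndDeriv k l y := by
  induction k with
  | zero => rfl
  | succ k ih =>
    rw [Function.iterate_succ_apply', ih]
    funext x
    rw [((hasDerivAt_fst_of_hasFDerivAt (hasFDerivAt_jet k l (x, y))).add_const _).deriv]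
    simp [sndDeriv]

lemma one_add_abs_pow_le (n : ℕ) (x : ℝ) :
    (1 + |x|) ^ n ≤ 2 ^ n * (1 + x ^ 2) ^ ((n : ℝ) / 2) := by
  have h : 1 + |x| ≤ 2 * √(1 + x ^ 2) := by
    have h1 : 1 ≤ √(1 + x ^ 2) := Real.one_le_sqrt.2 (by linarith [sq_nonneg x])
    have h2 : |x| ≤ √(1 + x ^ 2) := Real.abs_le_sqrt (by linarith)
    linarith
  rw [div_eq_inv_mul, Real.rpow_mul (by positivity), Real.rpow_natCast, ← one_div,
    ← Real.sqrt_eq_rpow, ← mul_pow]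
  gcongr

lemma iterate_deriv_flow_le (k l : ℕ) : ∃ c : ℝ, 0 < c ∧ ∀ x y : ℝ, |y| ≤ 1 →
    |deriv^[k] (fun x' => deriv^[l] (fun y' => flow x' y') y) x| ≤
      c * (1 + x ^ 2) ^ (((2 * l + 1 : ℕ) : ℝ) / 2) := by
  obtain ⟨C, hC, h⟩ := abs_jet_le k l
  refine ⟨(C + 1) * 2 ^ (2 * l + 1), by positivity, fun x y hy => ?_⟩
  simp only [iterate_deriv_snd_flow, iterate_deriv_fst_jet]
  have h1 : 1 ≤ (1 + |x|) ^ (2 * l + 1) := one_le_pow₀ (by linarith [abs_nonneg x])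
  calc |jet k l x y + sndDeriv k l y|
      ≤ C * (1 + |x|) ^ (2 * l + 1) + 1 :=
        (abs_add_le _ _).trans (add_le_add (h x y) (abs_sndDeriv_le k l hy))
    _ ≤ (C + 1) * (1 + |x|) ^ (2 * l + 1) := by linarith
    _ ≤ _ := by
        rw [mul_assoc]
        exact mul_le_mul_of_nonneg_left (one_add_abs_pow_le _ x) (by positivity)

end TransitiveFlow

theorem statement18 :
    ∃ τ : ℝ → ℝ → ℝ,
      ContDiff ℝ (⊤ : ℕ∞) (fun p : ℝ × ℝ => τ p.1 p.2) ∧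
      (∀ y : ℝ, τ 0 y = y) ∧
      (∀ x x' y : ℝ, τ x (τ x' y) = τ (x + x') y) ∧
      (∀ x y : ℝ, 1 ≤ |y| → τ x y = y) ∧
      (∀ k l : ℕ, ∃ c : ℝ, 0 < c ∧ ∀ x y : ℝ, |y| ≤ 1 →
        |deriv^[k] (fun x' => deriv^[l] (fun y' => τ x' y') y) x| ≤
          c * (1 + x ^ 2) ^ (((2 * l + 1 : ℕ) : ℝ) / 2)) ∧
      (∀ y ∈ Set.Ioo (-1 : ℝ) 1, Set.range (fun x => τ x y) = Set.Ioo (-1 : ℝ) 1) := by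
  open TransitiveFlow in
  refine ⟨flow, contDiff_flow, fun y => ?_, flow_flow, fun x y hy => ?_, iterate_deriv_flow_le,
    fun y hy => range_flow hy⟩
  · rw [flow, jet_zero_left, zero_add]
  · exact flow_of_notMem x fun h => hy.not_gt (abs_lt.2 h)
end
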